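/- arXiv:2202.02638 — 3 statements merged into one kernel-verified Lean document; each statement's English description precedes it below -/
import Mathlib

section
/- Let X be a virtual Markov chain. Then: (1) almost surely {S^0_N}_{N∈ℕ} ∈ 𝒮, and the law of S^0 is a staircase Markov chain; (2) for every a,k ∈ ℕ, almost surely S^{a,k}_N ∈ {0,…,N} and S^{a,k}_{N+1} ∈ {S^{a,k}_N, N+1} for all N ≥ a, and the process {S^{a,k}_N}_{N≥a} is a Markov chain: for all M > N ≥ a and all a_N,…,a_M ∈ ℕ with P(S^{a,k}_{N+1} = a_{N+1},…,S^{a,k}_M = a_M) > 0, one has P(S^{a,k}_N = a_N | S^{a,k}_{N+1} = a_{N+1},…,S^{a,k}_M = a_M) = P(S^{a,k}_N = a_N | S^{a,k}_{N+1} = a_{N+1}). -/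
open MeasureTheory Filter
open scoped ENNReal NNReal

namespace VMCPaper

abbrev Path : Type := ℕ → ℕ

def staircaseSet : Set Path :=
  {S | (∀ N, S N ≤ N) ∧ ∀ N, S (N + 1) = S N ∨ S (N + 1) = N + 1}

noncomputable def pr {α : Type*} [MeasurableSpace α] (μ : Measure α) (A : Set α) : ℝ :=
  (μ A).toReal

def IsSMC (μ : Measure Path) : Prop :=
  IsProbabilityMeasure μ ∧ μ staircaseSet = 1 ∧
  ∀ (N : ℕ) (a : ℕ → ℕ),
    0 < pr μ {S | ∀ i ≤ N, S i = a i} →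
    pr μ {S | (∀ i ≤ N, S i = a i) ∧ S (N + 1) = a (N + 1)} /
        pr μ {S | ∀ i ≤ N, S i = a i}
      = pr μ {S | S N = a N ∧ S (N + 1) = a (N + 1)} / pr μ {S | S N = a N}

noncomputable def marginals (μ : Measure Path) : ℕ → ℕ → ℝ :=
  fun N a => pr μ {S | S N = a}

def D : Set (ℕ → ℕ → ℝ) :=
  {ν | (∀ N a, 0 ≤ ν N a) ∧ (∀ N a, N < a → ν N a = 0) ∧
       (∀ N, ∑ a ∈ Finset.range (N + 1), ν N a = 1) ∧
       ∀ N a, a ≤ N → ν (N + 1) a ≤ ν N a}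

def PMC : Set (ProbabilityMeasure Path) := {μ | IsSMC (μ : Measure Path)}

def IsBalayage (π : ℕ → ℕ → ℝ) : Prop :=
  (∀ N a, 0 ≤ π N a) ∧ (∀ N a, N < a → π N a = 0) ∧
  ∀ N, ∑ a ∈ Finset.range (N + 1), π N a = 1

def Dpi (π : ℕ → ℕ → ℝ) : Set (ℕ → ℕ → ℝ) :=
  {ν | ν ∈ D ∧ ∀ N a, a ≤ N → ν N a = ν (N + 1) a + ν (N + 1) (N + 1) * π N a}

def PMCpi (π : ℕ → ℕ → ℝ) : Set (Measure Path) :=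
  {μ | IsSMC μ ∧ ∀ N a, a ≤ N →
    0 < pr μ {S | S (N + 1) = N + 1} →
    pr μ {S | S N = a ∧ S (N + 1) = N + 1} / pr μ {S | S (N + 1) = N + 1} = π N a}

def pathTail : MeasurableSpace Path :=
  ⨅ N : ℕ, MeasurableSpace.comap (fun (S : Path) (i : ℕ) => S (N + i)) inferInstance

def HasTrivialTail (μ : Measure Path) : Prop :=
  ∀ A : Set Path, MeasurableSet[pathTail] A → μ A = 0 ∨ μ A = 1

def AffineOn {E : Type*} [AddCommMonoid E] [Module ℝ E] (f : E → ℝ) (K : Set E) : Prop :=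
  ∀ x ∈ K, ∀ y ∈ K, ∀ t : ℝ, 0 ≤ t → t ≤ 1 →
    f (t • x + (1 - t) • y) = t * f x + (1 - t) * f y

def RepresentsOn {E : Type*} [AddCommMonoid E] [Module ℝ E] [TopologicalSpace E]
    [MeasurableSpace E] (m : Measure E) (K : Set E) (x : E) : Prop :=
  ∀ f : E → ℝ, ContinuousOn f K → AffineOn f K → f x = ∫ y, f y ∂m

def IsChoquetSimplex {E : Type*} [AddCommMonoid E] [Module ℝ E] [TopologicalSpace E]
    [MeasurableSpace E] (K : Set E) : Prop :=
  ∀ x ∈ K, ∃! m : Measure E,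
    IsProbabilityMeasure m ∧ m (Set.extremePoints ℝ K) = 1 ∧ RepresentsOn m K x

noncomputable def hitTime (x : Path) (A : Set ℕ) : ℕ → ℕ∞
  | 0 => ⨅ i ∈ {i : ℕ | x i ∈ A}, (i : ℕ∞)
  | k + 1 => ⨅ i ∈ {i : ℕ | hitTime x A k < (i : ℕ∞) ∧ x i ∈ A}, (i : ℕ∞)

noncomputable def proj (N : ℕ) (x : Path) : Path := fun i =>
  if hitTime x {a | a ≤ N} i = ⊤ then 0 else x (hitTime x {a | a ≤ N} i).toNat

def pathSpace (N : ℕ) : Set Path :=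
  {x | (∀ i, x i ≤ N) ∧ ∀ i, x i = 0 → ∀ j, i ≤ j → x j = 0}

def fullPathSpace : Set Path := {x | ∀ i, x i = 0 → ∀ j, i ≤ j → x j = 0}

def IsMarkovChain {Ω : Type*} [MeasurableSpace Ω] (P : Measure Ω) (Y : ℕ → Ω → ℕ) : Prop :=
  (∀ i, Measurable (Y i)) ∧
  (∀ (n : ℕ) (b : ℕ → ℕ),
    0 < (P {ω | ∀ i ≤ n, Y i ω = b i}).toReal →
    (P {ω | (∀ i ≤ n, Y i ω = b i) ∧ Y (n + 1) ω = b (n + 1)}).toReal /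
        (P {ω | ∀ i ≤ n, Y i ω = b i}).toReal
      = (P {ω | Y n ω = b n ∧ Y (n + 1) ω = b (n + 1)}).toReal /
        (P {ω | Y n ω = b n}).toReal) ∧
  (∀ m n b c : ℕ,
    0 < (P {ω | Y m ω = b}).toReal → 0 < (P {ω | Y n ω = b}).toReal →
    (P {ω | Y m ω = b ∧ Y (m + 1) ω = c}).toReal / (P {ω | Y m ω = b}).toReal
      = (P {ω | Y n ω = b ∧ Y (n + 1) ω = c}).toReal / (P {ω | Y n ω = b}).toReal)

def IsVMC {Ω : Type*} [MeasurableSpace Ω] (P : Measure Ω) (X : Ω → ℕ → Path) : Prop :=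
  IsProbabilityMeasure P ∧
  Measurable X ∧
  (∀ ω N, X ω N ∈ pathSpace N) ∧
  (∀ ω N, proj N (X ω (N + 1)) = X ω N) ∧
  ∀ N, IsMarkovChain P (fun i ω => X ω N i)

def S0 {Ω : Type*} (X : Ω → ℕ → Path) (N : ℕ) (ω : Ω) : ℕ := X ω N 0

noncomputable def Vis {Ω : Type*} (X : Ω → ℕ → Path) (a : ℕ) (ω : Ω) : ℕ∞ :=
  {k : ℕ | hitTime (X ω a) {a} k ≠ ⊤}.encard

open scoped Classical in
noncomputable def Sak {Ω : Type*} (X : Ω → ℕ → Path) (a k N : ℕ) (ω : Ω) : ℕ :=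
  if (k : ℕ∞) < Vis X a ω ∧ hitTime (X ω N) {a} k ≠ ⊤ then
    X ω N ((hitTime (X ω N) {a} k).toNat + 1)
  else 0

def InfinitelyVisited {Ω : Type*} [MeasurableSpace Ω] (P : Measure Ω)
    (X : Ω → ℕ → Path) (a : ℕ) : Prop := P {ω | Vis X a ω = ⊤} = 1

def OnceVisited {Ω : Type*} [MeasurableSpace Ω] (P : Measure Ω)
    (X : Ω → ℕ → Path) (a : ℕ) : Prop := P {ω | Vis X a ω = 1} = 1

def NeverVisited {Ω : Type*} [MeasurableSpace Ω] (P : Measure Ω)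
    (X : Ω → ℕ → Path) (a : ℕ) : Prop := P {ω | Vis X a ω = 0} = 1

def RandomlyVisited {Ω : Type*} [MeasurableSpace Ω] (P : Measure Ω)
    (X : Ω → ℕ → Path) (a : ℕ) : Prop :=
  ¬ InfinitelyVisited P X a ∧ ¬ OnceVisited P X a ∧ ¬ NeverVisited P X a

def sigmaX {Ω : Type*} (X : Ω → ℕ → Path) : MeasurableSpace Ω :=
  MeasurableSpace.comap X inferInstance

def tailVMC {Ω : Type*} (X : Ω → ℕ → Path) : MeasurableSpace Ω :=
  ⨅ N : ℕ, MeasurableSpace.comap (fun ω (M : ℕ) => X ω (N + M)) inferInstance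

def TailTrivial {Ω : Type*} [MeasurableSpace Ω] (P : Measure Ω) (X : Ω → ℕ → Path) : Prop :=
  ∀ A : Set Ω, MeasurableSet[tailVMC X] A → P A = 0 ∨ P A = 1

def RepresentedBy {Ω : Type*} [MeasurableSpace Ω] (P : Measure Ω) (X : Ω → ℕ → Path)
    (ν : ℕ → ℕ → ℝ) (K : ℕ → ℕ → ℕ → ℝ) : Prop :=
  (∀ N a, a ≤ N → (P {ω | X ω N 0 = a}).toReal = ν N a) ∧
  ∀ N a b, a ≤ N → b ≤ N → 0 < (P {ω | X ω N 0 = a}).toReal →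
    (P {ω | X ω N 0 = a ∧ X ω N 1 = b}).toReal / (P {ω | X ω N 0 = a}).toReal = K N a b

noncomputable def piK (K : ℕ → ℕ → ℕ → ℝ) (N : ℕ) (b : ℕ) : ℝ :=
  if K (N + 1) (N + 1) (N + 1) < 1 then
    K (N + 1) (N + 1) b / (1 - K (N + 1) (N + 1) (N + 1))
  else if b = 0 then 1 else 0

def IsVTM (K : ℕ → ℕ → ℕ → ℝ) : Prop :=
  (∀ N a b, 0 ≤ K N a b) ∧
  (∀ N a b, a ≤ N → N < b → K N a b = 0) ∧
  (∀ N a, a ≤ N → ∑ b ∈ Finset.range (N + 1), K N a b = 1) ∧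
  (∀ N, K N 0 0 = 1) ∧
  (∀ N a b, a ≤ N → b ≤ N → K N a b = K (N + 1) a b + K (N + 1) a (N + 1) * piK K N b)

def mpow (N : ℕ) (M : ℕ → ℕ → ℝ) : ℕ → ℕ → ℕ → ℝ
  | 0 => fun a b => if a = b then 1 else 0
  | n + 1 => fun a b => ∑ c ∈ Finset.range (N + 1), mpow N M n a c * M c b

def IsIrreducibleVTM (K : ℕ → ℕ → ℕ → ℝ) : Prop :=
  ∀ N, 1 ≤ N → ∀ a b, 1 ≤ a → a ≤ N → 1 ≤ b → b ≤ N →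
    ∃ n, 0 < mpow N (K N) n a b

def IsClassical {Ω : Type*} [MeasurableSpace Ω] (P : Measure Ω) (X : Ω → ℕ → Path) : Prop :=
  ∀ᵐ ω ∂P, ∃ x : Path, x ∈ fullPathSpace ∧
    (∀ i, ∀ᶠ N in atTop, X ω N i = x i) ∧ ∀ N, X ω N = proj N x


open Classical in
noncomputable def cnt (x : Path) (A : Set ℕ) : ℕ → ℕ
  | 0 => 0
  | t + 1 => cnt x A t + if x t ∈ A then 1 else 0

theorem cnt_succ_mem {x : Path} {A : Set ℕ} {t : ℕ} (h : x t ∈ A) :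
    cnt x A (t + 1) = cnt x A t + 1 := by simp [cnt, h]

theorem cnt_succ_not {x : Path} {A : Set ℕ} {t : ℕ} (h : x t ∉ A) :
    cnt x A (t + 1) = cnt x A t := by simp [cnt, h]

theorem cnt_mono (x : Path) (A : Set ℕ) : Monotone (cnt x A) :=
  monotone_nat_of_le_succ fun n => by simp [cnt]

theorem cnt_lt {x : Path} {A : Set ℕ} {u t : ℕ} (h : x u ∈ A) (hut : u < t) :
    cnt x A u < cnt x A t := by
  have := cnt_mono x A (show u + 1 ≤ t from hut)
  rw [cnt_succ_mem h] at this
  omega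

theorem cnt_exists {x : Path} {A : Set ℕ} {j : ℕ} : ∀ t, j < cnt x A t →
    ∃ u, u < t ∧ x u ∈ A ∧ cnt x A u = j := by
  intro t
  induction t with
  | zero => intro h; simp [cnt] at h
  | succ t ih =>
    intro h
    by_cases hj : j < cnt x A t
    · obtain ⟨u, h1, h2⟩ := ih hj
      exact ⟨u, by omega, h2⟩
    · by_cases hm : x t ∈ A
      · rw [cnt_succ_mem hm] at h
        exact ⟨t, by omega, hm, by omega⟩
      · rw [cnt_succ_not hm] at h
        omega

theorem cnt_inj {x : Path} {A : Set ℕ} {u t : ℕ} (hu : x u ∈ A) (ht : x t ∈ A)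
    (h : cnt x A u = cnt x A t) : u = t := by
  rcases lt_trichotomy u t with h1 | h1 | h1
  · have := cnt_lt hu h1; omega
  · exact h1
  · have := cnt_lt ht h1; omega

theorem cnt_congr {x y : Path} {A : Set ℕ} {t : ℕ} (h : ∀ i < t, x i = y i) :
    cnt x A t = cnt y A t := by
  induction t with
  | zero => rfl
  | succ t ih => simp only [cnt]; rw [ih (fun i hi => h i (by omega)), h t (by omega)]

theorem iInf_nat_eq (s : Set ℕ) (t : ℕ) : (⨅ i ∈ s, (i : ℕ∞)) = (t : ℕ∞) ↔
    t ∈ s ∧ ∀ j ∈ s, t ≤ j := by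
  constructor
  · intro h
    have h2 : ∀ j ∈ s, t ≤ j := fun j hj => by
      have : (⨅ i ∈ s, (i : ℕ∞)) ≤ j := iInf₂_le j hj
      rw [h] at this
      exact_mod_cast this
    refine ⟨?_, h2⟩
    by_contra hn
    have : ((t + 1 : ℕ) : ℕ∞) ≤ ⨅ i ∈ s, (i : ℕ∞) := by
      refine le_iInf₂ fun j hj => ?_
      have h3 := h2 j hj
      have : t ≠ j := fun e => hn (e ▸ hj)
      exact_mod_cast (by omega : t + 1 ≤ j)
    rw [h] at this
    have : t + 1 ≤ t := by exact_mod_cast this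
    omega
  · rintro ⟨h1, h2⟩
    apply le_antisymm
    · exact iInf₂_le t h1
    · exact le_iInf₂ fun j hj => by exact_mod_cast h2 j hj

theorem hitTime_eq {x : Path} {A : Set ℕ} (k : ℕ) : ∀ (t : ℕ), hitTime x A k = (t : ℕ∞) ↔
    x t ∈ A ∧ cnt x A t = k := by
  induction k with
  | zero =>
    intro t
    rw [hitTime, iInf_nat_eq]
    constructor
    · rintro ⟨h1, h2⟩
      refine ⟨h1, ?_⟩
      by_contra h
      obtain ⟨u, hu, hu2, -⟩ := cnt_exists (x := x) (A := A) (j := 0) t (by omega)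
      have := h2 u hu2
      omega
    · rintro ⟨h1, h2⟩
      refine ⟨h1, fun j hj => ?_⟩
      by_contra h
      have := cnt_lt (x := x) (A := A) (u := j) (t := t) hj (by omega)
      omega
  | succ k ih =>
    intro t
    rw [hitTime, iInf_nat_eq]
    constructor
    · rintro ⟨⟨h1, h1'⟩, h2⟩
      refine ⟨h1', ?_⟩
      obtain ⟨s, hs⟩ := ENat.ne_top_iff_exists.1 (ne_top_of_lt h1)
      have hs2 := (ih s).1 hs.symm
      rw [← hs] at h1
      have hst : s < t := by exact_mod_cast h1
      have h3 := cnt_lt hs2.1 hst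
      by_contra h
      obtain ⟨u, hu, hu2, hu3⟩ := cnt_exists (x := x) (A := A) (j := k + 1) t (by omega)
      have hsu : s < u := by
        by_contra hh
        have := cnt_mono x A (show u ≤ s by omega)
        omega
      have := h2 u ⟨by rw [← hs]; exact_mod_cast hsu, hu2⟩
      omega
    · rintro ⟨h1, h2⟩
      obtain ⟨s, hs1, hs2, hs3⟩ := cnt_exists (x := x) (A := A) (j := k) t (by omega)
      have hs := (ih s).2 ⟨hs2, hs3⟩
      refine ⟨⟨by rw [hs]; exact_mod_cast hs1, h1⟩, ?_⟩
      rintro j ⟨hj1, hj2⟩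
      rw [hs] at hj1
      have hj1 : s < j := by exact_mod_cast hj1
      have := cnt_lt hs2 hj1
      by_contra h
      have := cnt_lt (t := t) hj2 (by omega)
      omega

theorem hitTime_top {x : Path} {A : Set ℕ} {k : ℕ} : hitTime x A k ≠ ⊤ ↔
    ∃ t, x t ∈ A ∧ cnt x A t = k := by
  rw [ENat.ne_top_iff_exists]
  constructor
  · rintro ⟨t, h⟩; exact ⟨t, (hitTime_eq k t).1 h.symm⟩
  · rintro ⟨t, h⟩; exact ⟨t, ((hitTime_eq k t).2 h).symm⟩

theorem proj_cnt {x : Path} {N t : ℕ} (h : x t ≤ N) :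
    proj N x (cnt x {a | a ≤ N} t) = x t := by
  have := (hitTime_eq (A := {a | a ≤ N}) (cnt x {a | a ≤ N} t) t).2 ⟨h, rfl⟩
  simp [proj, this]

theorem proj_cases (x : Path) (N i : ℕ) :
    (∃ t, x t ≤ N ∧ cnt x {a | a ≤ N} t = i ∧ proj N x i = x t) ∨ proj N x i = 0 := by
  by_cases h : hitTime x {a | a ≤ N} i = ⊤
  · right; simp [proj, h]
  · left
    obtain ⟨t, h1, h2⟩ := hitTime_top.1 h
    exact ⟨t, h1, h2, by rw [← h2]; exact proj_cnt h1⟩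

theorem cnt_proj {x : Path} {N a : ℕ} (ha : a ≤ N) (t : ℕ) :
    cnt (proj N x) {a} (cnt x {a | a ≤ N} t) = cnt x {a} t := by
  induction t with
  | zero => rfl
  | succ t ih =>
    by_cases h : x t ≤ N
    · rw [cnt_succ_mem (A := {a | a ≤ N}) h]
      simp only [cnt]
      rw [ih, proj_cnt h]
    · rw [cnt_succ_not (A := {a | a ≤ N}) h, ih, cnt_succ_not]
      simp only [Set.mem_singleton_iff]
      omega

open Classical in
noncomputable def fb (x : Path) (t i : ℕ) : ℕ :=
  if h : ∃ s, t ≤ s ∧ x s ≤ i then x (Nat.find h) else 0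

theorem fb_some {x : Path} {t i s : ℕ} (hts : t ≤ s) (hs : x s ≤ i)
    (h : ∀ u, t ≤ u → u < s → i < x u) : fb x t i = x s := by
  have hex : ∃ s, t ≤ s ∧ x s ≤ i := ⟨s, hts, hs⟩
  rw [fb, dif_pos hex]
  congr 1
  rw [Nat.find_eq_iff]
  refine ⟨⟨hts, hs⟩, fun u hu hh => ?_⟩
  have := h u hh.1 hu
  have := hh.2
  omega

theorem fb_none {x : Path} {t i : ℕ} (h : ∀ s, t ≤ s → i < x s) : fb x t i = 0 := by
  rw [fb, dif_neg]
  rintro ⟨s, h1, h2⟩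
  have := h s h1
  omega

theorem fb_cases (x : Path) (t i : ℕ) :
    (∃ s, t ≤ s ∧ x s ≤ i ∧ ∀ u, t ≤ u → u < s → i < x u) ∨ ∀ s, t ≤ s → i < x s := by
  by_cases hex : ∃ s, t ≤ s ∧ x s ≤ i
  · left
    refine ⟨Nat.find hex, (Nat.find_spec hex).1, (Nat.find_spec hex).2, fun u h1 h2 => ?_⟩
    have := Nat.find_min hex h2
    by_contra hh
    exact this ⟨h1, by omega⟩
  · right
    intro s hs
    by_contra hh
    exact hex ⟨s, hs, by omega⟩

theorem fb_le (x : Path) (t i : ℕ) : fb x t i ≤ i := by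
  rcases fb_cases x t i with ⟨s, h1, h2, h3⟩ | h
  · rw [fb_some h1 h2 h3]; exact h2
  · rw [fb_none h]; omega

theorem fb_proj {x : Path} {N i : ℕ} (hi : i ≤ N) (t : ℕ) :
    fb (proj N x) (cnt x {a | a ≤ N} t) i = fb x t i := by
  have key : ∀ u, x u ≤ N → cnt x {a | a ≤ N} t ≤ cnt x {a | a ≤ N} u → t ≤ u := by
    intro u hu h
    by_contra hh
    have := cnt_lt (A := {a | a ≤ N}) (t := t) hu (by omega)
    omega
  rcases fb_cases x t i with ⟨s, h1, h2, h3⟩ | h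
  · rw [fb_some h1 h2 h3]
    have hs : x s ≤ N := h2.trans hi
    rw [fb_some (s := cnt x {a | a ≤ N} s) (cnt_mono _ _ h1) (by rw [proj_cnt hs]; exact h2),
      proj_cnt hs]
    intro u' hu1 hu2
    obtain ⟨u, hu3, hu4, rfl⟩ := cnt_exists s hu2
    rw [proj_cnt hu4]
    exact h3 u (key u hu4 hu1) hu3
  · rw [fb_none h]
    rcases fb_cases (proj N x) (cnt x {a | a ≤ N} t) i with ⟨s, h1, h2, h3⟩ | h'
    · rw [fb_some h1 h2 h3]
      rcases proj_cases x N s with ⟨u, hu1, rfl, hu3⟩ | h0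
      · have := h u (key u hu1 h1)
        omega
      · exact h0
    · rw [fb_none h']

/-- if nothing at or below `L` on `[t,n)` then the clock can be moved. -/
theorem fb_move {x : Path} {t n L i : ℕ} (hi : i ≤ L) (htn : t ≤ n)
    (h : ∀ u, t ≤ u → u < n → L < x u) : fb x t i = fb x n i := by
  rcases fb_cases x n i with ⟨s, h1, h2, h3⟩ | h'
  · rw [fb_some h1 h2 h3, fb_some (htn.trans h1) h2]
    intro u hu hus
    by_cases hun : u < n
    · exact hi.trans_lt (h u hu hun)
    · exact h3 u (by omega) hus
  · rw [fb_none h', fb_none]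
    intro u hu
    by_cases hun : u < n
    · exact hi.trans_lt (h u hu hun)
    · exact h' u (by omega)

theorem fb_shift (x : Path) (n i : ℕ) : fb (fun j => x (n + j)) 0 i = fb x n i := by
  rcases fb_cases x n i with ⟨s, h1, h2, h3⟩ | h'
  · rw [fb_some h1 h2 h3]
    obtain ⟨r, rfl⟩ := Nat.exists_eq_add_of_le h1
    exact fb_some (x := fun j => x (n + j)) (Nat.zero_le r) h2
      (fun u _ hu => h3 _ (by omega) (by omega))
  · rw [fb_none h', fb_none]
    intro s _
    exact h' _ (by omega)

theorem fb_congr {x y : Path} {t n i : ℕ} (hxy : ∀ j ≤ n, x j = y j)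
    (h : ∃ s, t ≤ s ∧ s ≤ n ∧ x s ≤ i) : fb x t i = fb y t i := by
  obtain ⟨s0, h01, h02, h03⟩ := h
  rcases fb_cases x t i with ⟨s, h1, h2, h3⟩ | h'
  · have hs : s ≤ n := by
      by_contra hh
      have := h3 s0 h01 (by omega)
      omega
    rw [fb_some h1 h2 h3, fb_some (x := y) h1 (by rw [← hxy s hs]; exact h2), hxy s hs]
    intro u hu hus
    rw [← hxy u (by omega)]
    exact h3 u hu hus
  · have := h' s0 h01
    omega

theorem fb_succ (x : Path) (t i : ℕ) : fb x t (i + 1) = fb x t i ∨ fb x t (i + 1) = i + 1 := by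
  rcases fb_cases x t (i + 1) with ⟨s, h1, h2, h3⟩ | h'
  · rw [fb_some h1 h2 h3]
    by_cases h : x s = i + 1
    · right; exact h
    · left
      rw [fb_some h1 (by omega)]
      intro u hu hus
      have := h3 u hu hus
      omega
  · left
    rw [fb_none h', fb_none]
    intro s hs
    have := h' s hs
    omega

theorem fb_self {x : Path} {t i : ℕ} (h : x t ≤ i) : fb x t i = x t :=
  fb_some le_rfl h (fun u _ _ => by omega)

theorem measurable_fb (i : ℕ) : Measurable (fun x : Path => fb x 0 i) := by
  refine measurable_to_countable' fun v => ?_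
  have : (fun x : Path => fb x 0 i) ⁻¹' {v} =
      (⋃ s, {x : Path | x s ≤ i} ∩ {x | x s = v} ∩ ⋂ u, {x : Path | u < s → i < x u}) ∪
      ({x : Path | v = 0} ∩ ⋂ s, {x : Path | i < x s}) := by
    ext x
    simp only [Set.mem_preimage, Set.mem_singleton_iff, Set.mem_union, Set.mem_iUnion,
      Set.mem_inter_iff, Set.mem_ofPred_eq, Set.mem_iInter]
    constructor
    · rintro rfl
      rcases fb_cases x 0 i with ⟨s, h1, h2, h3⟩ | h'
      · left
        exact ⟨s, ⟨h2, (fb_some h1 h2 h3).symm⟩, fun u hu => h3 u (by omega) hu⟩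
      · right
        exact ⟨fb_none h', fun s => h' s (by omega)⟩
    · rintro (⟨s, ⟨h1, rfl⟩, h2⟩ | ⟨rfl, h⟩)
      · exact fb_some (by omega) h1 (fun u _ hu => h2 u hu)
      · exact fb_none fun s _ => h s
  rw [this]
  have hm : ∀ (s : ℕ) (T : Set ℕ), MeasurableSet {x : Path | x s ∈ T} := fun s T =>
    measurable_pi_apply s (MeasurableSet.of_discrete (s := T))
  refine MeasurableSet.union (MeasurableSet.iUnion fun s => ?_) ?_
  · refine ((hm s {v | v ≤ i}).inter (hm s {w | w = v})).inter (MeasurableSet.iInter fun u => ?_)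
    exact hm u {w | u < s → i < w}
  · exact (MeasurableSet.const _).inter (MeasurableSet.iInter fun s => hm s {w | i < w})

theorem trans_exists {Ω : Type*} [MeasurableSpace Ω] (P : Measure Ω) [IsProbabilityMeasure P]
    {Y : ℕ → Ω → ℕ} (h : IsMarkovChain P Y) :
    ∃ p : ℕ → ℕ → ℝ≥0∞, ∀ (n : ℕ) (b : ℕ → ℕ),
      P {ω | ∀ i ≤ n + 1, Y i ω = b i} = P {ω | ∀ i ≤ n, Y i ω = b i} * p (b n) (b (n + 1)) := by
  classical
  obtain ⟨hm, h1, h2⟩ := h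
  let p : ℕ → ℕ → ℝ≥0∞ := fun b c =>
    if h : ∃ n, 0 < (P {ω | Y n ω = b}).toReal then
      ENNReal.ofReal ((P {ω | Y h.choose ω = b ∧ Y (h.choose + 1) ω = c}).toReal /
        (P {ω | Y h.choose ω = b}).toReal) else 0
  refine ⟨p, fun n b => ?_⟩
  have hset : {ω | ∀ i ≤ n + 1, Y i ω = b i} =
      {ω | (∀ i ≤ n, Y i ω = b i) ∧ Y (n + 1) ω = b (n + 1)} := by
    ext ω
    simp only [Set.mem_ofPred_eq]
    constructor
    · intro hh
      exact ⟨fun i hi => hh i (by omega), hh _ le_rfl⟩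
    · rintro ⟨ha, hb⟩ i hi
      rcases Nat.lt_or_ge i (n + 1) with hi' | hi'
      · exact ha i (by omega)
      · have : i = n + 1 := by omega
        subst this
        exact hb
  rw [hset]
  by_cases h0 : P {ω | ∀ i ≤ n, Y i ω = b i} = 0
  · rw [h0, zero_mul]
    exact measure_mono_null (fun ω hω => hω.1) h0
  have hpos : 0 < (P {ω | ∀ i ≤ n, Y i ω = b i}).toReal :=
    ENNReal.toReal_pos h0 (measure_ne_top _ _)
  have hn : 0 < (P {ω | Y n ω = b n}).toReal :=
    hpos.trans_le (ENNReal.toReal_mono (measure_ne_top _ _)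
      (measure_mono fun ω hω => hω n le_rfl))
  have hex : ∃ n', 0 < (P {ω | Y n' ω = b n}).toReal := ⟨n, hn⟩
  have hp : p (b n) (b (n + 1)) = ENNReal.ofReal
      ((P {ω | Y n ω = b n ∧ Y (n + 1) ω = b (n + 1)}).toReal /
        (P {ω | Y n ω = b n}).toReal) := by
    simp only [p]
    rw [dif_pos hex, h2 _ n _ _ hex.choose_spec hn]
  rw [hp, ← h1 n b hpos, ENNReal.ofReal_div_of_pos hpos, ENNReal.ofReal_toReal (measure_ne_top _ _),
    ENNReal.ofReal_toReal (measure_ne_top _ _), ENNReal.mul_div_cancel h0 (measure_ne_top _ _)]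

theorem hist_prod {Ω : Type*} [MeasurableSpace Ω] {P : Measure Ω}
    {Y : ℕ → Ω → ℕ} {p : ℕ → ℕ → ℝ≥0∞} (hp : ∀ (n : ℕ) (b : ℕ → ℕ),
      P {ω | ∀ i ≤ n + 1, Y i ω = b i} = P {ω | ∀ i ≤ n, Y i ω = b i} * p (b n) (b (n + 1)))
    (n l : ℕ) (b : ℕ → ℕ) : P {ω | ∀ i ≤ n + l, Y i ω = b i} =
      P {ω | ∀ i ≤ n, Y i ω = b i} * ∏ j ∈ Finset.range l, p (b (n + j)) (b (n + j + 1)) := by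
  induction l with
  | zero => simp
  | succ l ih => rw [← add_assoc, hp, ih, Finset.prod_range_succ, mul_assoc]

theorem measurableSet_hist {Ω : Type*} [MeasurableSpace Ω]
    {Y : ℕ → Ω → ℕ} (hm : ∀ i, Measurable (Y i)) (n : ℕ) (b : ℕ → ℕ) :
    MeasurableSet {ω | ∀ i ≤ n, Y i ω = b i} := by
  have : {ω | ∀ i ≤ n, Y i ω = b i} = ⋂ i, ⋂ (_ : i ≤ n), Y i ⁻¹' {b i} := by
    ext ω; simp
  rw [this]
  exact MeasurableSet.iInter fun i => MeasurableSet.iInter fun _ => hm i (MeasurableSet.singleton _)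

theorem hist_shift {Ω : Type*} [MeasurableSpace Ω] {P : Measure Ω}
    {Y : ℕ → Ω → ℕ} {p : ℕ → ℕ → ℝ≥0∞} (hp : ∀ (n : ℕ) (b : ℕ → ℕ),
      P {ω | ∀ i ≤ n + 1, Y i ω = b i} = P {ω | ∀ i ≤ n, Y i ω = b i} * p (b n) (b (n + 1)))
    (n l : ℕ) (b d : ℕ → ℕ) (hd : d 0 = b n) :
    P ({ω | ∀ i ≤ l, Y (n + i) ω = d i} ∩ {ω | ∀ i ≤ n, Y i ω = b i}) =
      P {ω | ∀ i ≤ n, Y i ω = b i} * ∏ j ∈ Finset.range l, p (d j) (d (j + 1)) := by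
  let b' : ℕ → ℕ := fun j => if j ≤ n then b j else d (j - n)
  have hb1 : ∀ j ≤ n, b' j = b j := fun j hj => by simp [b', hj]
  have hb2 : ∀ j, b' (n + j) = d j := fun j => by
    rcases Nat.eq_zero_or_pos j with rfl | hj
    · simp [b', hd]
    · simp [b', show j ≠ 0 by omega]
  have e1 : {ω | ∀ i ≤ n, Y i ω = b i} = {ω | ∀ i ≤ n, Y i ω = b' i} := by
    ext ω
    simp only [Set.mem_ofPred_eq]
    exact forall₂_congr fun i hi => by rw [hb1 i hi]
  have e2 : {ω | ∀ i ≤ l, Y (n + i) ω = d i} ∩ {ω | ∀ i ≤ n, Y i ω = b i} =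
      {ω | ∀ i ≤ n + l, Y i ω = b' i} := by
    ext ω
    simp only [Set.mem_inter_iff, Set.mem_ofPred_eq]
    constructor
    · rintro ⟨h1, h2⟩ i hi
      by_cases hin : i ≤ n
      · rw [hb1 i hin]; exact h2 i hin
      · obtain ⟨j, rfl⟩ := Nat.exists_eq_add_of_le (show n ≤ i by omega)
        rw [hb2]; exact h1 j (by omega)
    · intro h
      refine ⟨fun i hi => ?_, fun i hi => ?_⟩
      · rw [← hb2]; exact h _ (by omega)
      · rw [← hb1 i hi]; exact h _ (by omega)
  rw [e2, e1, hist_prod hp]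
  congr 1
  refine Finset.prod_congr rfl fun j _ => ?_
  rw [hb2, add_assoc, hb2]

theorem atom_cross {Ω : Type*} [MeasurableSpace Ω] (P : Measure Ω) [IsProbabilityMeasure P]
    {Y : ℕ → Ω → ℕ} (h : IsMarkovChain P Y) {n m : ℕ} {b b' : ℕ → ℕ} (hb : b n = b' m)
    {F : Set Path} (hF : MeasurableSet F) :
    P {ω | ∀ i ≤ m, Y i ω = b' i} *
      P ({ω | (fun i => Y (n + i) ω) ∈ F} ∩ {ω | ∀ i ≤ n, Y i ω = b i}) =
    P {ω | ∀ i ≤ n, Y i ω = b i} *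
      P ({ω | (fun i => Y (m + i) ω) ∈ F} ∩ {ω | ∀ i ≤ m, Y i ω = b' i}) := by
  obtain ⟨p, hp⟩ := trans_exists P h
  have hm := h.1
  have hθ : ∀ n, Measurable (fun ω (i : ℕ) => Y (n + i) ω) := fun n =>
    measurable_pi_lambda _ fun i => hm _
  set μ : Measure Path := (P {ω | ∀ i ≤ m, Y i ω = b' i}) •
    (P.restrict {ω | ∀ i ≤ n, Y i ω = b i}).map (fun ω (i : ℕ) => Y (n + i) ω) with hμ
  set ν : Measure Path := (P {ω | ∀ i ≤ n, Y i ω = b i}) •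
    (P.restrict {ω | ∀ i ≤ m, Y i ω = b' i}).map (fun ω (i : ℕ) => Y (m + i) ω) with hν
  have hμF : ∀ F : Set Path, MeasurableSet F → μ F = P {ω | ∀ i ≤ m, Y i ω = b' i} *
      P ({ω | (fun i => Y (n + i) ω) ∈ F} ∩ {ω | ∀ i ≤ n, Y i ω = b i}) := fun F hF => by
    rw [hμ, Measure.smul_apply, Measure.map_apply (hθ n) hF,
      Measure.restrict_apply (hθ n hF), smul_eq_mul]
    rfl
  have hνF : ∀ F : Set Path, MeasurableSet F → ν F = P {ω | ∀ i ≤ n, Y i ω = b i} *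
      P ({ω | (fun i => Y (m + i) ω) ∈ F} ∩ {ω | ∀ i ≤ m, Y i ω = b' i}) := fun F hF => by
    rw [hν, Measure.smul_apply, Measure.map_apply (hθ m) hF,
      Measure.restrict_apply (hθ m hF), smul_eq_mul]
    rfl
  rw [← hμF F hF, ← hνF F hF]
  have hfμ : IsFiniteMeasure μ := ⟨by
    rw [hμF _ MeasurableSet.univ]
    exact ENNReal.mul_lt_top (measure_lt_top _ _) (measure_lt_top _ _)⟩
  suffices hh : μ = ν by rw [hh]
  -- cylinders
  have hcyl : ∀ (l : ℕ) (d : ℕ → ℕ), μ {x | ∀ i ≤ l, x i = d i} = ν {x | ∀ i ≤ l, x i = d i} := by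
    intro l d
    have hms : MeasurableSet {x : Path | ∀ i ≤ l, x i = d i} :=
      measurableSet_hist (Y := fun i (x : Path) => x i) (fun i => measurable_pi_apply i) l d
    rw [hμF _ hms, hνF _ hms]
    by_cases hd : d 0 = b n
    · have e1 := hist_shift hp n l b d hd
      have e2 := hist_shift hp m l b' d (hd.trans hb)
      simp only [Set.mem_ofPred_eq]
      rw [e1, e2]
      ring
    · have z1 : {ω | (fun i => Y (n + i) ω) ∈ {x : Path | ∀ i ≤ l, x i = d i}} ∩
          {ω | ∀ i ≤ n, Y i ω = b i} = ∅ := by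
        ext ω
        simp only [Set.mem_inter_iff, Set.mem_ofPred_eq, Set.mem_empty_iff_false, iff_false]
        rintro ⟨h1, h2⟩
        exact hd ((h1 0 (by omega)).symm.trans (h2 n le_rfl))
      have z2 : {ω | (fun i => Y (m + i) ω) ∈ {x : Path | ∀ i ≤ l, x i = d i}} ∩
          {ω | ∀ i ≤ m, Y i ω = b' i} = ∅ := by
        ext ω
        simp only [Set.mem_inter_iff, Set.mem_ofPred_eq, Set.mem_empty_iff_false, iff_false]
        rintro ⟨h1, h2⟩
        exact hd (((h1 0 (by omega)).symm.trans (h2 m le_rfl)).trans hb.symm)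
      rw [z1, z2]
      simp
  have hpr : ∀ l : ℕ, μ.map (Preorder.frestrictLe l) =
      ν.map (Preorder.frestrictLe (π := fun _ => ℕ) l) := by
    intro l
    refine Measure.ext_of_singleton fun g => ?_
    rw [Measure.map_apply (by fun_prop) (MeasurableSet.singleton _),
      Measure.map_apply (by fun_prop) (MeasurableSet.singleton _)]
    have : (Preorder.frestrictLe (π := fun _ => ℕ) l) ⁻¹' {g} =
        {x : Path | ∀ i ≤ l, x i = if hi : i ∈ Finset.Iic l then g ⟨i, hi⟩ else 0} := by
      ext x
      simp only [Set.mem_preimage, Set.mem_singleton_iff, Set.mem_ofPred_eq]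
      constructor
      · rintro rfl i hi
        rw [dif_pos (by simpa using hi)]
        rfl
      · intro hx
        funext ⟨i, hi⟩
        have := hx i (by simpa using hi)
        rw [dif_pos hi] at this
        exact this
    rw [this]
    exact hcyl l _
  have hproj : IsProjectiveLimit ν (fun I : Finset ℕ => μ.map I.restrict) := by
    intro I
    obtain ⟨l, hl⟩ : ∃ l, I ⊆ Finset.Iic l := ⟨I.sup id, fun i hi => by
      simpa using Finset.le_sup (f := id) hi⟩
    have e : (I.restrict (π := fun _ => ℕ)) =
        Finset.restrict₂ (π := fun _ => ℕ) hl ∘ (Preorder.frestrictLe (π := fun _ => ℕ) l) := rfl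
    show ν.map I.restrict = μ.map I.restrict
    rw [e, ← Measure.map_map (by fun_prop) (by fun_prop),
      ← Measure.map_map (by fun_prop) (by fun_prop), hpr l]
  exact IsProjectiveLimit.unique (P := fun I : Finset ℕ => μ.map I.restrict)
    (fun I => rfl) hproj

theorem atom_q {Ω : Type*} [MeasurableSpace Ω] (P : Measure Ω) [IsProbabilityMeasure P]
    {Y : ℕ → Ω → ℕ} (h : IsMarkovChain P Y) (c : ℕ)
    {F : Set Path} (hF : MeasurableSet F) :
    ∃ q : ℝ≥0∞, ∀ (n : ℕ) (b : ℕ → ℕ), b n = c →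
      P ({ω | (fun i => Y (n + i) ω) ∈ F} ∩ {ω | ∀ i ≤ n, Y i ω = b i}) =
        P {ω | ∀ i ≤ n, Y i ω = b i} * q := by
  by_cases hex : ∃ (m : ℕ) (b' : ℕ → ℕ), b' m = c ∧ P {ω | ∀ i ≤ m, Y i ω = b' i} ≠ 0
  · obtain ⟨m, b', hb', h0⟩ := hex
    refine ⟨P ({ω | (fun i => Y (m + i) ω) ∈ F} ∩ {ω | ∀ i ≤ m, Y i ω = b' i}) /
      P {ω | ∀ i ≤ m, Y i ω = b' i}, fun n b hb => ?_⟩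
    have := atom_cross P h (n := n) (m := m) (b := b) (b' := b') (hb.trans hb'.symm) hF
    rw [← mul_div_assoc, ← this, mul_comm, ENNReal.mul_div_cancel_right h0 (measure_ne_top _ _)]
  · refine ⟨0, fun n b hb => ?_⟩
    push Not at hex
    rw [mul_zero]
    exact measure_mono_null Set.inter_subset_right (hex n b hb)

theorem det_measurable {Ω : Type*}
    {Y : ℕ → Ω → ℕ} (n : ℕ) (G : Set Path)
    (hG : ∀ x y : Path, (∀ j ≤ n, x j = y j) → x ∈ G → y ∈ G) :
    ∃ B : Set (Fin (n + 1) → ℕ), {ω | (fun i => Y i ω) ∈ G} =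
      (fun ω (i : Fin (n + 1)) => Y i ω) ⁻¹' B := by
  refine ⟨{g | (fun j => if hj : j < n + 1 then g ⟨j, hj⟩ else 0) ∈ G}, ?_⟩
  ext ω
  simp only [Set.mem_ofPred_eq, Set.mem_preimage]
  constructor
  · apply hG
    intro j hj
    rw [dif_pos (by omega)]
  · apply hG
    intro j hj
    rw [dif_pos (by omega)]

theorem det_q {Ω : Type*} [MeasurableSpace Ω] (P : Measure Ω) [IsProbabilityMeasure P]
    {Y : ℕ → Ω → ℕ} (hm : ∀ i, Measurable (Y i)) {c : ℕ}
    {F : Set Path} (hF : MeasurableSet F) {q : ℝ≥0∞}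
    (hq : ∀ (n : ℕ) (b : ℕ → ℕ), b n = c →
      P ({ω | (fun i => Y (n + i) ω) ∈ F} ∩ {ω | ∀ i ≤ n, Y i ω = b i}) =
        P {ω | ∀ i ≤ n, Y i ω = b i} * q) (n : ℕ) (G : Set Path)
    (hG : ∀ x y : Path, (∀ j ≤ n, x j = y j) → x ∈ G → y ∈ G) (hc : ∀ x ∈ G, x n = c) :
    P ({ω | (fun i => Y i ω) ∈ G} ∩ {ω | (fun i => Y (n + i) ω) ∈ F}) =
      P {ω | (fun i => Y i ω) ∈ G} * q := by
  have hZ : Measurable (fun ω (i : Fin (n + 1)) => Y i ω) :=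
    measurable_pi_lambda _ fun i => hm _
  have hFm : MeasurableSet {ω | (fun i => Y (n + i) ω) ∈ F} :=
    (measurable_pi_lambda (fun ω (i : ℕ) => Y (n + i) ω) fun i => hm _) hF
  have hcm : MeasurableSet {ω | Y n ω = c} := hm n (MeasurableSet.singleton c)
  have key : (P.restrict ({ω | (fun i => Y (n + i) ω) ∈ F} ∩ {ω | Y n ω = c})).map
      (fun ω (i : Fin (n + 1)) => Y i ω) =
      q • (P.restrict {ω | Y n ω = c}).map (fun ω (i : Fin (n + 1)) => Y i ω) := by
    refine Measure.ext_of_singleton fun g => ?_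
    rw [Measure.smul_apply, Measure.map_apply hZ (MeasurableSet.singleton _),
      Measure.map_apply hZ (MeasurableSet.singleton _),
      Measure.restrict_apply (hZ (MeasurableSet.singleton _)),
      Measure.restrict_apply (hZ (MeasurableSet.singleton _)), smul_eq_mul]
    have e : (fun ω (i : Fin (n + 1)) => Y i ω) ⁻¹' {g} =
        {ω | ∀ i ≤ n, Y i ω = if hi : i < n + 1 then g ⟨i, hi⟩ else 0} := by
      ext ω
      simp only [Set.mem_preimage, Set.mem_singleton_iff, Set.mem_ofPred_eq]
      constructor
      · rintro rfl i hi
        rw [dif_pos (by omega)]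
      · intro hx
        funext ⟨i, hi⟩
        have := hx i (by omega)
        rw [dif_pos hi] at this
        exact this
    rw [e]
    by_cases hg : g ⟨n, by omega⟩ = c
    · have := hq n (fun i => if hi : i < n + 1 then g ⟨i, hi⟩ else 0) (by simpa using hg)
      have s1 : {ω | ∀ i ≤ n, Y i ω = if hi : i < n + 1 then g ⟨i, hi⟩ else 0} ⊆
          {ω | Y n ω = c} := fun ω hω => by
        have := hω n le_rfl
        rw [dif_pos (by omega)] at this
        exact this.trans hg
      rw [← Set.inter_assoc, Set.inter_eq_left.2 (Set.inter_subset_left.trans s1),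
        Set.inter_eq_left.2 s1, Set.inter_comm, this, mul_comm]
    · have s1 : ∀ ω, ω ∈ {ω | ∀ i ≤ n, Y i ω = if hi : i < n + 1 then g ⟨i, hi⟩ else 0} →
          Y n ω ≠ c := fun ω hω => by
        have := hω n le_rfl
        rw [dif_pos (by omega)] at this
        rw [this]; exact hg
      have z2 : {ω | ∀ i ≤ n, Y i ω = if hi : i < n + 1 then g ⟨i, hi⟩ else 0} ∩
          {ω | Y n ω = c} = ∅ := by
        rw [← Set.disjoint_iff_inter_eq_empty, Set.disjoint_left]
        exact s1
      rw [z2, measure_empty, mul_zero]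
      refine measure_mono_null ?_ (measure_empty (μ := P))
      rw [← z2]
      exact fun ω hω => ⟨hω.1, hω.2.2⟩
  obtain ⟨B, hB⟩ := det_measurable (Y := Y) n G hG
  have hBm : MeasurableSet B := MeasurableSet.of_discrete
  have := congrArg (fun μ => μ B) key
  rw [Measure.smul_apply, Measure.map_apply hZ hBm, Measure.map_apply hZ hBm,
      Measure.restrict_apply (hZ hBm), Measure.restrict_apply (hZ hBm), smul_eq_mul, ← hB] at this
  have s1 : {ω | (fun i => Y i ω) ∈ G} ⊆ {ω | Y n ω = c} := fun ω hω => hc _ hω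
  rw [← Set.inter_assoc, Set.inter_eq_left.2 (Set.inter_subset_left.trans s1),
        Set.inter_eq_left.2 s1] at this
  rw [this, mul_comm]

theorem strong_q {Ω : Type*} [MeasurableSpace Ω] (P : Measure Ω) [IsProbabilityMeasure P]
    {Y : ℕ → Ω → ℕ} (h : IsMarkovChain P Y) (c : ℕ)
    {F : Set Path} (hF : MeasurableSet F) :
    ∃ q : ℝ≥0∞, ∀ G : ℕ → Set Path,
      (∀ n, ∀ x y : Path, (∀ j ≤ n, x j = y j) → x ∈ G n → y ∈ G n) →
      (∀ n, ∀ x ∈ G n, x n = c) → (∀ n m x, x ∈ G n → x ∈ G m → n = m) →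
      P {ω | ∃ n, (fun i => Y i ω) ∈ G n ∧ (fun i => Y (n + i) ω) ∈ F} =
        P {ω | ∃ n, (fun i => Y i ω) ∈ G n} * q := by
  obtain ⟨q, hq⟩ := atom_q P h c hF
  refine ⟨q, fun G hG hc hd => ?_⟩
  have hm := h.1
  have hGm : ∀ n, MeasurableSet {ω | (fun i => Y i ω) ∈ G n} := fun n => by
    obtain ⟨B, hB⟩ := det_measurable (Y := Y) n (G n) (hG n)
    rw [hB]
    exact (measurable_pi_lambda _ fun i => hm _) MeasurableSet.of_discrete
  have hFm : ∀ n, MeasurableSet {ω | (fun i => Y (n + i) ω) ∈ F} := fun n =>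
    (measurable_pi_lambda (fun ω (i : ℕ) => Y (n + i) ω) fun i => hm _) hF
  have e1 : {ω | ∃ n, (fun i => Y i ω) ∈ G n ∧ (fun i => Y (n + i) ω) ∈ F} =
      ⋃ n, ({ω | (fun i => Y i ω) ∈ G n} ∩ {ω | (fun i => Y (n + i) ω) ∈ F}) := by
    ext ω; simp
  have e2 : {ω | ∃ n, (fun i => Y i ω) ∈ G n} = ⋃ n, {ω | (fun i => Y i ω) ∈ G n} := by
    ext ω; simp
  have d2 : Pairwise (Function.onFun Disjoint fun n => {ω | (fun i => Y i ω) ∈ G n}) := by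
    intro n m hnm
    rw [Function.onFun, Set.disjoint_left]
    exact fun ω h1 h2 => hnm (hd n m _ h1 h2)
  have d1 : Pairwise (Function.onFun Disjoint fun n =>
      {ω | (fun i => Y i ω) ∈ G n} ∩ {ω | (fun i => Y (n + i) ω) ∈ F}) := by
    intro n m hnm
    exact (d2 hnm).mono Set.inter_subset_left Set.inter_subset_left
  rw [e1, e2, measure_iUnion d1 (fun n => (hGm n).inter (hFm n)), measure_iUnion d2 hGm,
    ← ENNReal.tsum_mul_right]
  exact tsum_congr fun n => det_q P hm hF hq n (G n) (hG n) (hc n)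

open Classical in
noncomputable def gval (st : Path → ℕ → Prop) (x : Path) (i : ℕ) : ℕ :=
  if h : ∃ t, st x t then fb x h.choose i else 0

structure GoodStart (st : Path → ℕ → Prop) : Prop where
  congr : ∀ x y t, (∀ j < t, x j = y j) → st x t → st y t
  uniq : ∀ x t s, st x t → st x s → t = s

theorem gval_eq {st : Path → ℕ → Prop} (hst : GoodStart st) {x : Path} {t : ℕ} (h : st x t)
    (i : ℕ) : gval st x i = fb x t i := by
  have hex : ∃ t, st x t := ⟨t, h⟩
  rw [gval, dif_pos hex, hst.uniq x _ _ hex.choose_spec h]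

theorem gval_none {st : Path → ℕ → Prop} {x : Path} (h : ¬ ∃ t, st x t)
    (i : ℕ) : gval st x i = 0 := by
  rw [gval, dif_neg h]

theorem gval_le (st : Path → ℕ → Prop) (x : Path) (i : ℕ) : gval st x i ≤ i := by
  rw [gval]
  split_ifs
  · exact fb_le _ _ _
  · omega

theorem gval_succ (st : Path → ℕ → Prop) (x : Path) (i : ℕ) :
    gval st x (i + 1) = gval st x i ∨ gval st x (i + 1) = i + 1 := by
  simp only [gval]
  split_ifs
  · exact fb_succ _ _ _
  · left; rfl

theorem gval_proj {st : Path → ℕ → Prop} (hst : GoodStart st) {N : ℕ}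
    (h1 : ∀ x t, st x t → st (proj N x) (cnt x {a | a ≤ N} t))
    (h2 : ∀ x t, st (proj N x) t → ∃ s, st x s) (x : Path) {i : ℕ} (hi : i ≤ N) :
    gval st (proj N x) i = gval st x i := by
  by_cases h : ∃ t, st x t
  · obtain ⟨t, ht⟩ := h
    rw [gval_eq hst ht, gval_eq hst (h1 x t ht), fb_proj hi]
  · rw [gval_none h, gval_none]
    rintro ⟨t, ht⟩
    exact h (h2 x t ht)

def Gset (st : Path → ℕ → Prop) (L c : ℕ) (B : Set Path) (n : ℕ) : Set Path :=
  {x | x n = c ∧ c ≤ L ∧ (∃ t, t ≤ n ∧ st x t ∧ ∀ u, t ≤ u → u < n → L < x u) ∧ gval st x ∈ B}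

theorem Gset_det {st : Path → ℕ → Prop} (hst : GoodStart st) {L c : ℕ} {B : Set Path}
    (hB : ∀ u v : Path, (∀ i, L ≤ i → u i = v i) → u ∈ B → v ∈ B) (n : ℕ) (x y : Path)
    (hxy : ∀ j ≤ n, x j = y j) (hx : x ∈ Gset st L c B n) : y ∈ Gset st L c B n := by
  obtain ⟨h1, h2, ⟨t, h3, h4, h5⟩, h6⟩ := hx
  have hy : st y t := hst.congr x y t (fun j hj => hxy j (by omega)) h4
  refine ⟨(hxy n le_rfl).symm.trans h1, h2, ⟨t, h3, hy, fun u hu hun => ?_⟩, ?_⟩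
  · rw [← hxy u (by omega)]; exact h5 u hu hun
  · refine hB _ _ (fun i hi => ?_) h6
    rw [gval_eq hst h4, gval_eq hst hy]
    exact fb_congr hxy ⟨n, h3, le_rfl, by omega⟩

theorem Gset_uniq {st : Path → ℕ → Prop} (hst : GoodStart st) {L c : ℕ} {B : Set Path}
    (n m : ℕ) (x : Path) (hn : x ∈ Gset st L c B n) (hm : x ∈ Gset st L c B m) : n = m := by
  obtain ⟨h1, h2, ⟨t, h3, h4, h5⟩, h6⟩ := hn
  obtain ⟨k1, k2, ⟨s, k3, k4, k5⟩, k6⟩ := hm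
  obtain rfl := hst.uniq x _ _ h4 k4
  rcases lt_trichotomy n m with h | h | h
  · have := k5 n h3 h; omega
  · exact h
  · have := h5 m k3 h; omega

theorem Gset_iff {st : Path → ℕ → Prop} (hst : GoodStart st) {L c : ℕ} (hc : c ≠ 0) {B : Set Path}
    (x : Path) : (∃ n, x ∈ Gset st L c B n) ↔ gval st x ∈ B ∧ gval st x L = c := by
  constructor
  · rintro ⟨n, h1, h2, ⟨t, h3, h4, h5⟩, h6⟩
    refine ⟨h6, ?_⟩
    rw [gval_eq hst h4, fb_some h3 (by omega) h5, h1]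
  · rintro ⟨h1, h2⟩
    by_cases h : ∃ t, st x t
    · obtain ⟨t, ht⟩ := h
      rw [gval_eq hst ht] at h2
      rcases fb_cases x t L with ⟨s, k1, k2, k3⟩ | h'
      · rw [fb_some k1 k2 k3] at h2
        exact ⟨s, h2, by omega, ⟨t, k1, ht, k3⟩, h1⟩
      · rw [fb_none h'] at h2
        exact absurd h2.symm hc
    · rw [gval_none h] at h2
      exact absurd h2.symm hc

theorem Gset_fut {st : Path → ℕ → Prop} (hst : GoodStart st) {L c : ℕ} {B F : Set Path}
    (hF : ∀ u v : Path, (∀ i, i ≤ L → u i = v i) → u ∈ F → v ∈ F) {n : ℕ} {x : Path}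
    (hx : x ∈ Gset st L c B n) :
    gval st x ∈ F ↔ (fun i => fb (fun j => x (n + j)) 0 i) ∈ F := by
  obtain ⟨h1, h2, ⟨t, h3, h4, h5⟩, h6⟩ := hx
  have : ∀ i, i ≤ L → gval st x i = fb (fun j => x (n + j)) 0 i := fun i hi => by
    rw [gval_eq hst h4, fb_shift, fb_move hi h3 h5]
  exact ⟨hF _ _ this, hF _ _ fun i hi => (this i hi).symm⟩

theorem main_cross {Ω : Type*} [MeasurableSpace Ω] (P : Measure Ω) [IsProbabilityMeasure P]
    {Y : Ω → Path} (h : IsMarkovChain P (fun i ω => Y ω i)) {st : Path → ℕ → Prop}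
    (hst : GoodStart st) {L c : ℕ} (hc : c ≠ 0) {B F : Set Path}
    (hB : ∀ u v : Path, (∀ i, L ≤ i → u i = v i) → u ∈ B → v ∈ B)
    (hF : ∀ u v : Path, (∀ i, i ≤ L → u i = v i) → u ∈ F → v ∈ F) (hFm : MeasurableSet F) :
    P {ω | gval st (Y ω) ∈ B ∧ gval st (Y ω) L = c ∧ gval st (Y ω) ∈ F} *
      P {ω | gval st (Y ω) L = c} =
    P {ω | gval st (Y ω) ∈ B ∧ gval st (Y ω) L = c} *
      P {ω | gval st (Y ω) L = c ∧ gval st (Y ω) ∈ F} := by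
  have hF' : MeasurableSet {x : Path | (fun i => fb x 0 i) ∈ F} :=
    (measurable_pi_lambda (fun x i => fb x 0 i) fun i => measurable_fb i) hFm
  obtain ⟨q, hq⟩ := strong_q P h c hF'
  have key : ∀ B : Set Path, (∀ u v : Path, (∀ i, L ≤ i → u i = v i) → u ∈ B → v ∈ B) →
      P {ω | gval st (Y ω) ∈ B ∧ gval st (Y ω) L = c ∧ gval st (Y ω) ∈ F} =
      P {ω | gval st (Y ω) ∈ B ∧ gval st (Y ω) L = c} * q := by
    intro B hB
    have := hq (Gset st L c B) (Gset_det hst hB) (fun n x hx => hx.1) (Gset_uniq hst)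
    have e1 : {ω | gval st (Y ω) ∈ B ∧ gval st (Y ω) L = c} =
        {ω | ∃ n, (fun i => Y ω i) ∈ Gset st L c B n} := by
      ext ω
      exact (Gset_iff hst hc (Y ω)).symm
    have e2 : {ω | gval st (Y ω) ∈ B ∧ gval st (Y ω) L = c ∧ gval st (Y ω) ∈ F} =
        {ω | ∃ n, (fun i => Y ω i) ∈ Gset st L c B n ∧
          (fun i => Y ω (n + i)) ∈ {x : Path | (fun i => fb x 0 i) ∈ F}} := by
      ext ω
      simp only [Set.mem_ofPred_eq]
      constructor
      · rintro ⟨h1, h2, h3⟩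
        obtain ⟨n, hn⟩ := (Gset_iff hst hc (Y ω)).2 ⟨h1, h2⟩
        exact ⟨n, hn, (Gset_fut hst hF hn).1 h3⟩
      · rintro ⟨n, hn, h3⟩
        obtain ⟨h1, h2⟩ := (Gset_iff hst hc (Y ω)).1 ⟨n, hn⟩
        exact ⟨h1, h2, (Gset_fut hst hF hn).2 h3⟩
    rw [e1, e2, this]
  have k1 := key B hB
  have k2 := key Set.univ (fun _ _ _ _ => trivial)
  simp only [Set.mem_univ, true_and] at k2
  rw [k1, k2]
  ring

theorem real_of_cross {a b c d : ℝ≥0∞} (hb : 0 < b.toReal) (hd : 0 < d.toReal)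
    (h : a * d = b * c) : a.toReal / b.toReal = c.toReal / d.toReal := by
  rw [div_eq_div_iff hb.ne' hd.ne', ← ENNReal.toReal_mul, h, ENNReal.toReal_mul, mul_comm]

theorem goodStart_zero : GoodStart (fun _ t => t = 0) :=
  ⟨fun _ _ _ _ h => h, fun _ _ _ h1 h2 => h1.trans h2.symm⟩

theorem goodStart_hit (a k : ℕ) :
    GoodStart (fun x t => ∃ s, t = s + 1 ∧ x s = a ∧ cnt x {a} s = k) := by
  constructor
  · rintro x y t hxy ⟨s, rfl, h1, h2⟩
    refine ⟨s, rfl, (hxy s (by omega)).symm.trans h1, ?_⟩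
    rw [← h2]
    exact (cnt_congr fun i hi => hxy i (by omega)).symm
  · rintro x t t' ⟨s, rfl, h1, h2⟩ ⟨s', rfl, h1', h2'⟩
    rw [cnt_inj (A := {a}) (x := x) (by simpa using h1) (by simpa using h1') (h2.trans h2'.symm)]

theorem hit_proj1 {a k N : ℕ} (ha : a ≤ N) (x : Path) (s : ℕ)
    (h : x s = a ∧ cnt x {a} s = k) :
    proj N x (cnt x {a | a ≤ N} s) = a ∧ cnt (proj N x) {a} (cnt x {a | a ≤ N} s) = k := by
  rw [proj_cnt (by omega), cnt_proj ha]
  exact h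

theorem hit_proj2 {a k N : ℕ} (ha : a ≤ N) (ha0 : a ≠ 0) (x : Path) (s : ℕ)
    (h : proj N x s = a ∧ cnt (proj N x) {a} s = k) :
    ∃ t, x t = a ∧ cnt x {a} t = k := by
  rcases proj_cases x N s with ⟨t, h1, rfl, h3⟩ | h0
  · refine ⟨t, h3.symm.trans h.1, ?_⟩
    rw [← h.2, cnt_proj ha]
  · exact absurd (h0.symm.trans h.1).symm ha0

theorem lt_encard {s : Set ℕ} (hs : ∀ i j, i ≤ j → j ∈ s → i ∈ s) (k : ℕ) :
    (k : ℕ∞) < s.encard ↔ k ∈ s := by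
  constructor
  · intro h
    by_contra hk
    have : s ⊆ (Finset.range k : Set ℕ) := fun j hj => by
      by_contra hh
      simp only [Finset.coe_range, Set.mem_Iio, not_lt] at hh
      exact hk (hs k j hh hj)
    have := Set.encard_le_encard this
    rw [Set.encard_coe_eq_coe_finsetCard, Finset.card_range] at this
    exact absurd h (not_lt.2 this)
  · intro hk
    have : (Finset.range (k + 1) : Set ℕ) ⊆ s := fun j hj => by
      simp only [Finset.coe_range, Set.mem_Iio] at hj
      exact hs j k (by omega) hk
    have := Set.encard_le_encard this
    rw [Set.encard_coe_eq_coe_finsetCard, Finset.card_range] at this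
    refine lt_of_lt_of_le ?_ this
    exact_mod_cast Nat.lt_succ_self k

theorem lt_vis {Ω : Type*} (X : Ω → ℕ → Path) (a k : ℕ) (ω : Ω) :
    (k : ℕ∞) < Vis X a ω ↔ ∃ t, X ω a t = a ∧ cnt (X ω a) {a} t = k := by
  rw [Vis, lt_encard]
  · exact hitTime_top
  · intro i j hij hj
    obtain ⟨t, h1, h2⟩ := hitTime_top.1 hj
    refine hitTime_top.2 ?_
    rcases hij.eq_or_lt with rfl | hlt
    · exact ⟨t, h1, h2⟩
    · obtain ⟨u, -, hu⟩ := cnt_exists (x := X ω a) (A := {a}) (j := i) t (by omega)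
      exact ⟨u, hu⟩

theorem meas_coord (s : ℕ) (T : Set ℕ) : MeasurableSet {x : Path | x s ∈ T} :=
  measurable_pi_apply s (MeasurableSet.of_discrete (s := T))

section final

variable {Ω : Type*} [MeasurableSpace Ω] {P : Measure Ω} {X : Ω → ℕ → Path}

theorem hit_levels (hX : IsVMC P X) {a k : ℕ} (ha0 : a ≠ 0) (ω : Ω) {N : ℕ} (haN : a ≤ N) :
    (∃ t, X ω a t = a ∧ cnt (X ω a) {a} t = k) ↔ ∃ t, X ω N t = a ∧ cnt (X ω N) {a} t = k := by
  induction N, haN using Nat.le_induction with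
  | base => rfl
  | succ N hN ih =>
    rw [ih, ← hX.2.2.2.1 ω N]
    constructor
    · rintro ⟨t, ht⟩
      exact hit_proj2 hN ha0 _ t ht
    · rintro ⟨t, ht⟩
      exact ⟨_, hit_proj1 hN _ t ht⟩

theorem gval_levels (hX : IsVMC P X) {st : Path → ℕ → Prop} (hst : GoodStart st) {a : ℕ}
    (h1 : ∀ N, a ≤ N → ∀ x t, st x t → st (proj N x) (cnt x {a | a ≤ N} t))
    (h2 : ∀ N, a ≤ N → ∀ x t, st (proj N x) t → ∃ s, st x s) (ω : Ω) {i M : ℕ} (hai : a ≤ i)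
    (hiM : i ≤ M) : gval st (X ω M) i = gval st (X ω i) i := by
  induction M, hiM using Nat.le_induction with
  | base => rfl
  | succ M hM ih =>
    rw [← ih, ← gval_proj hst (h1 M (by omega)) (h2 M (by omega)) _ hM, hX.2.2.2.1 ω M]

theorem S0_eq (hX : IsVMC P X) (ω : Ω) {i M : ℕ} (hiM : i ≤ M) :
    S0 X i ω = gval (fun _ t => t = 0) (X ω M) i := by
  rw [gval_levels hX goodStart_zero (a := 0) _ _ ω (Nat.zero_le i) hiM,
    gval_eq goodStart_zero rfl, fb_self ((hX.2.2.1 ω i).1 0), S0]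
  · rintro N - x t rfl; rfl
  · rintro N - x t rfl; exact ⟨0, rfl⟩

theorem Sak_eq (hX : IsVMC P X) {a : ℕ} (ha0 : a ≠ 0) (k : ℕ) (ω : Ω) {i M : ℕ} (hai : a ≤ i)
    (hiM : i ≤ M) : Sak X a k i ω =
      gval (fun x t => ∃ s, t = s + 1 ∧ x s = a ∧ cnt x {a} s = k) (X ω M) i := by
  rw [gval_levels hX (goodStart_hit a k) (a := a) _ _ ω hai hiM, Sak]
  · by_cases h : ∃ t, X ω i t = a ∧ cnt (X ω i) {a} t = k
    · have hv := (lt_vis X a k ω).2 ((hit_levels hX ha0 ω hai).2 h)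
      obtain ⟨t, ht⟩ := h
      have hh : hitTime (X ω i) {a} k = (t : ℕ∞) := (hitTime_eq k t).2 ht
      rw [if_pos ⟨hv, by rw [hh]; simp⟩, hh,
        gval_eq (goodStart_hit a k) (t := t + 1) ⟨t, rfl, ht⟩, fb_self ((hX.2.2.1 ω i).1 _)]
      simp
    · rw [if_neg, gval_none]
      · rintro ⟨t, s, -, hs⟩
        exact h ⟨s, hs⟩
      · rintro ⟨-, hh⟩
        exact h (hitTime_top.1 hh)
  · rintro N hN x t ⟨s, rfl, hs⟩
    refine ⟨cnt x {a | a ≤ N} s, cnt_succ_mem ?_, hit_proj1 hN x s hs⟩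
    simp only [Set.mem_ofPred_eq]
    omega
  · rintro N hN x t ⟨s, rfl, hs⟩
    obtain ⟨u, hu⟩ := hit_proj2 hN ha0 x s hs
    exact ⟨u + 1, u, rfl, hu⟩

theorem Sak_zero (hX : IsVMC P X) (k : ℕ) (ω : Ω) (i : ℕ) : Sak X 0 k i ω = 0 := by
  rw [Sak]
  split_ifs with h
  · obtain ⟨t, ht⟩ := hitTime_top.1 h.2
    have hh : hitTime (X ω i) {0} k = (t : ℕ∞) := (hitTime_eq k t).2 ht
    rw [hh]
    exact (hX.2.2.1 ω i).2 t ht.1 _ (by simp)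
  · rfl

theorem stair_ak (hX : IsVMC P X) (a k : ℕ) (ω : Ω) {N : ℕ} (haN : a ≤ N) :
    Sak X a k N ω ≤ N ∧
      (Sak X a k (N + 1) ω = Sak X a k N ω ∨ Sak X a k (N + 1) ω = N + 1) := by
  by_cases ha0 : a = 0
  · subst ha0
    simp [Sak_zero hX]
  · rw [Sak_eq hX ha0 k ω haN (Nat.le_succ N), Sak_eq hX ha0 k ω (haN.trans (Nat.le_succ N)) le_rfl]
    exact ⟨gval_le _ _ _, gval_succ _ _ _⟩

theorem stair_0 (hX : IsVMC P X) (ω : Ω) (N : ℕ) :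
    S0 X N ω ≤ N ∧ (S0 X (N + 1) ω = S0 X N ω ∨ S0 X (N + 1) ω = N + 1) := by
  rw [S0_eq hX ω (Nat.le_succ N), S0_eq hX ω (le_refl (N + 1))]
  exact ⟨gval_le _ _ _, gval_succ _ _ _⟩

theorem ak_markov (hX : IsVMC P X) (a k N M : ℕ) (haN : a ≤ N) (hNM : N < M) (b : ℕ → ℕ)
    (hpos : 0 < (P {ω | ∀ i, N + 1 ≤ i → i ≤ M → Sak X a k i ω = b i}).toReal) :
    (P {ω | Sak X a k N ω = b N ∧ ∀ i, N + 1 ≤ i → i ≤ M → Sak X a k i ω = b i}).toReal /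
        (P {ω | ∀ i, N + 1 ≤ i → i ≤ M → Sak X a k i ω = b i}).toReal
      = (P {ω | Sak X a k N ω = b N ∧ Sak X a k (N + 1) ω = b (N + 1)}).toReal /
        (P {ω | Sak X a k (N + 1) ω = b (N + 1)}).toReal := by
  have := hX.1
  have hpos2 : 0 < (P {ω | Sak X a k (N + 1) ω = b (N + 1)}).toReal :=
    hpos.trans_le (ENNReal.toReal_mono (measure_ne_top _ _)
      (measure_mono fun ω hω => hω (N + 1) le_rfl hNM))
  by_cases hb : b (N + 1) = N + 1
  · have ha0 : a ≠ 0 := by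
      rintro rfl
      have : {ω | Sak X 0 k (N + 1) ω = b (N + 1)} = ∅ := by
        ext ω
        simp [Sak_zero hX, hb]
      rw [this] at hpos2
      simp at hpos2
    refine real_of_cross hpos hpos2 ?_
    have := main_cross P (hX.2.2.2.2 M) (goodStart_hit a k) (L := N + 1) (c := N + 1) (by omega)
      (B := {u | ∀ i, N + 1 ≤ i → i ≤ M → u i = b i}) (F := {u | u N = b N})
      (fun u v huv hu i h1 h2 => by rw [← huv i h1]; exact hu i h1 h2)
      (fun u v huv hu => by
        simp only [Set.mem_ofPred_eq] at hu ⊢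
        rw [← huv N (by omega)]; exact hu)
      (meas_coord N {b N})
    have hS : ∀ ω i, N ≤ i → i ≤ M → gval (fun x t => ∃ s, t = s + 1 ∧ x s = a ∧ cnt x {a} s = k)
        (X ω M) i = Sak X a k i ω := fun ω i h1 h2 =>
      (Sak_eq hX ha0 k ω (haN.trans h1) h2).symm
    have hS' : ∀ ω, (∀ i, N + 1 ≤ i → i ≤ M →
        gval (fun x t => ∃ s, t = s + 1 ∧ x s = a ∧ cnt x {a} s = k) (X ω M) i = b i) ↔
        (∀ i, N + 1 ≤ i → i ≤ M → Sak X a k i ω = b i) := fun ω =>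
      forall₃_congr fun i h1 h2 => by rw [hS ω i (by omega) h2]
    simp only [Set.mem_ofPred_eq, hS', hS _ N le_rfl hNM.le, hS _ (N + 1) (by omega) hNM] at this
    have e1 : {ω | Sak X a k N ω = b N ∧ ∀ i, N + 1 ≤ i → i ≤ M → Sak X a k i ω = b i} =
      {ω | (∀ i, N + 1 ≤ i → i ≤ M → Sak X a k i ω = b i) ∧ Sak X a k (N + 1) ω = N + 1 ∧
        Sak X a k N ω = b N} := by
      ext ω
      constructor
      · rintro ⟨h1, h2⟩
        exact ⟨h2, (h2 (N + 1) le_rfl hNM).trans hb, h1⟩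
      · rintro ⟨h1, h2, h3⟩
        exact ⟨h3, h1⟩
    have e2 : {ω | ∀ i, N + 1 ≤ i → i ≤ M → Sak X a k i ω = b i} =
      {ω | (∀ i, N + 1 ≤ i → i ≤ M → Sak X a k i ω = b i) ∧ Sak X a k (N + 1) ω = N + 1} := by
      ext ω
      constructor
      · intro h2
        exact ⟨h2, (h2 (N + 1) le_rfl hNM).trans hb⟩
      · rintro ⟨h1, h2⟩
        exact h1
    have e3 : {ω | Sak X a k N ω = b N ∧ Sak X a k (N + 1) ω = b (N + 1)} =
        {ω | Sak X a k (N + 1) ω = N + 1 ∧ Sak X a k N ω = b N} := by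
      ext ω
      simp only [Set.mem_ofPred_eq, hb]
      tauto
    rw [e1, e3, hb, this, ← e2]
  · have hdet : ∀ ω, Sak X a k (N + 1) ω = b (N + 1) → Sak X a k N ω = b (N + 1) := by
      intro ω h
      rcases (stair_ak hX a k ω haN).2 with h1 | h1
      · rw [← h1, h]
      · exact absurd (h.symm.trans h1) hb
    by_cases hbb : b N = b (N + 1)
    · have e1 : {ω | Sak X a k N ω = b N ∧ ∀ i, N + 1 ≤ i → i ≤ M → Sak X a k i ω = b i} =
        {ω | ∀ i, N + 1 ≤ i → i ≤ M → Sak X a k i ω = b i} := by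
        ext ω
        exact ⟨fun h => h.2, fun h => ⟨by rw [hbb]; exact hdet ω (h _ le_rfl hNM), h⟩⟩
      have e2 : {ω | Sak X a k N ω = b N ∧ Sak X a k (N + 1) ω = b (N + 1)} =
        {ω | Sak X a k (N + 1) ω = b (N + 1)} := by
        ext ω
        exact ⟨fun h => h.2, fun h => ⟨by rw [hbb]; exact hdet ω h, h⟩⟩
      rw [e1, e2, div_self hpos.ne', div_self hpos2.ne']
    · have e1 : {ω | Sak X a k N ω = b N ∧ ∀ i, N + 1 ≤ i → i ≤ M → Sak X a k i ω = b i} = ∅ := by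
        ext ω
        simp only [Set.mem_ofPred_eq, Set.mem_empty_iff_false, iff_false]
        rintro ⟨h1, h2⟩
        exact hbb (h1.symm.trans (hdet ω (h2 _ le_rfl hNM)))
      have e2 : {ω | Sak X a k N ω = b N ∧ Sak X a k (N + 1) ω = b (N + 1)} = ∅ := by
        ext ω
        simp only [Set.mem_ofPred_eq, Set.mem_empty_iff_false, iff_false]
        rintro ⟨h1, h2⟩
        exact hbb (h1.symm.trans (hdet ω h2))
      rw [e1, e2]
      simp

theorem s0_markov (hX : IsVMC P X) (N : ℕ) (a : ℕ → ℕ)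
    (hpos : 0 < (P {ω | ∀ i ≤ N, S0 X i ω = a i}).toReal) :
    (P {ω | (∀ i ≤ N, S0 X i ω = a i) ∧ S0 X (N + 1) ω = a (N + 1)}).toReal /
        (P {ω | ∀ i ≤ N, S0 X i ω = a i}).toReal
      = (P {ω | S0 X N ω = a N ∧ S0 X (N + 1) ω = a (N + 1)}).toReal /
        (P {ω | S0 X N ω = a N}).toReal := by
  have := hX.1
  have hpos2 : 0 < (P {ω | S0 X N ω = a N}).toReal :=
    hpos.trans_le (ENNReal.toReal_mono (measure_ne_top _ _)
      (measure_mono fun ω hω => hω N le_rfl))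
  by_cases hc : a N = 0
  · have hdown : ∀ ω, S0 X N ω = 0 → ∀ i ≤ N, S0 X i ω = 0 := by
      intro ω h i hi
      refine Nat.decreasingInduction (motive := fun i _ => S0 X i ω = 0) ?_ h hi
      intro j hj h0
      rcases (stair_0 hX ω j).2 with h1 | h1
      · rw [← h1, h0]
      · omega
    have ha : ∀ i ≤ N, a i = 0 := by
      have hne : {ω | ∀ i ≤ N, S0 X i ω = a i}.Nonempty := by
        by_contra hh
        rw [Set.not_nonempty_iff_eq_empty] at hh
        rw [hh] at hpos
        simp at hpos
      obtain ⟨ω, hω⟩ := hne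
      intro i hi
      rw [← hω i hi]
      exact hdown ω ((hω N le_rfl).trans hc) i hi
    have hiff : ∀ ω, (∀ i ≤ N, S0 X i ω = a i) ↔ S0 X N ω = a N := fun ω =>
      ⟨fun h => h N le_rfl, fun h i hi => by rw [ha i hi]; exact hdown ω (h.trans hc) i hi⟩
    simp only [hiff]
  · refine real_of_cross hpos hpos2 ?_
    have := main_cross P (hX.2.2.2.2 (N + 1)) goodStart_zero (L := N) (c := a N) hc
      (B := {u | u (N + 1) = a (N + 1)}) (F := {u | ∀ i ≤ N, u i = a i})
      (fun u v huv hu => by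
        simp only [Set.mem_ofPred_eq] at hu ⊢
        rw [← huv (N + 1) (by omega)]; exact hu)
      (fun u v huv hu i h1 => by rw [← huv i h1]; exact hu i h1)
      (measurableSet_hist (Y := fun i (x : Path) => x i) (fun i => measurable_pi_apply i) N a)
    have hS : ∀ ω i, i ≤ N + 1 → gval (fun _ t => t = 0) (X ω (N + 1)) i = S0 X i ω :=
      fun ω i h2 => (S0_eq hX ω h2).symm
    have hS' : ∀ ω, (∀ i ≤ N, gval (fun _ t => t = 0) (X ω (N + 1)) i = a i) ↔
        (∀ i ≤ N, S0 X i ω = a i) := fun ω =>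
      forall₂_congr fun i h1 => by rw [hS ω i (by omega)]
    simp only [Set.mem_ofPred_eq, hS', hS _ N (Nat.le_succ N), hS _ (N + 1) le_rfl] at this
    have e1 : {ω | (∀ i ≤ N, S0 X i ω = a i) ∧ S0 X (N + 1) ω = a (N + 1)} =
        {ω | S0 X (N + 1) ω = a (N + 1) ∧ S0 X N ω = a N ∧ ∀ i ≤ N, S0 X i ω = a i} := by
      ext ω
      exact ⟨fun h => ⟨h.2, h.1 N le_rfl, h.1⟩, fun h => ⟨h.2.2, h.1⟩⟩
    have e2 : {ω | ∀ i ≤ N, S0 X i ω = a i} =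
        {ω | S0 X N ω = a N ∧ ∀ i ≤ N, S0 X i ω = a i} := by
      ext ω
      exact ⟨fun h => ⟨h N le_rfl, h⟩, fun h => h.2⟩
    have e3 : {ω | S0 X N ω = a N ∧ S0 X (N + 1) ω = a (N + 1)} =
        {ω | S0 X (N + 1) ω = a (N + 1) ∧ S0 X N ω = a N} := by
      ext ω
      exact and_comm
    rw [e1, e3, this, mul_comm, ← e2]

theorem measurableSet_staircase : MeasurableSet staircaseSet := by
  have : staircaseSet = (⋂ N, {S : Path | S N ≤ N}) ∩
      ⋂ N, ({S : Path | S (N + 1) = S N} ∪ {S : Path | S (N + 1) = N + 1}) := by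
    ext S
    simp [staircaseSet]
  rw [this]
  refine (MeasurableSet.iInter fun N => ?_).inter (MeasurableSet.iInter fun N => ?_)
  · exact meas_coord N {v | v ≤ N}
  · exact (measurableSet_eq_fun (measurable_pi_apply (N + 1)) (measurable_pi_apply N)).union
      (meas_coord (N + 1) {N + 1})

theorem s0_smc (hX : IsVMC P X) : IsSMC (P.map (fun ω N => S0 X N ω)) := by
  have := hX.1
  have hm : Measurable (fun ω N => S0 X N ω) :=
    measurable_pi_lambda _ fun N => (hX.2.2.2.2 N).1 0
  refine ⟨Measure.isProbabilityMeasure_map hm.aemeasurable, ?_, fun N a => ?_⟩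
  · rw [Measure.map_apply hm measurableSet_staircase]
    have : (fun ω N => S0 X N ω) ⁻¹' staircaseSet = Set.univ := by
      ext ω
      simp only [Set.mem_preimage, Set.mem_univ, iff_true]
      exact ⟨fun N => (stair_0 hX ω N).1, fun N => (stair_0 hX ω N).2⟩
    rw [this, measure_univ]
  · have h1 : MeasurableSet {S : Path | ∀ i ≤ N, S i = a i} :=
      measurableSet_hist (Y := fun i (x : Path) => x i) (fun i => measurable_pi_apply i) N a
    have h2 : ∀ N, MeasurableSet {S : Path | S N = a N} := fun N =>
      meas_coord N {a N}
    have h3 : MeasurableSet {S : Path | (∀ i ≤ N, S i = a i) ∧ S (N + 1) = a (N + 1)} :=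
      h1.inter (h2 (N + 1))
    have h4 : MeasurableSet {S : Path | S N = a N ∧ S (N + 1) = a (N + 1)} :=
      (h2 N).inter (h2 (N + 1))
    simp only [pr]
    rw [Measure.map_apply hm h1, Measure.map_apply hm (h2 N),
      Measure.map_apply hm h3,
      Measure.map_apply hm h4]
    exact s0_markov hX N a

end final

/-- for a VMC `X`, almost surely `S^0 ∈ 𝒮` and its law is a staircase Markov
chain; and each `S^{a,k}` is almost surely a staircase above level `a` and satisfies the
(backwards) Markov property at levels `≥ a`. -/
theorem statement12 {Ω : Type*} [MeasurableSpace Ω] (P : Measure Ω) (X : Ω → ℕ → Path)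
    (hX : IsVMC P X) :
    ((∀ᵐ ω ∂P, (fun N => S0 X N ω) ∈ staircaseSet) ∧
      IsSMC (P.map (fun ω N => S0 X N ω))) ∧
    ∀ a k : ℕ,
      (∀ᵐ ω ∂P, ∀ N, a ≤ N →
        Sak X a k N ω ≤ N ∧
        (Sak X a k (N + 1) ω = Sak X a k N ω ∨ Sak X a k (N + 1) ω = N + 1)) ∧
      (∀ (N M : ℕ), a ≤ N → N < M → ∀ b : ℕ → ℕ,
        0 < (P {ω | ∀ i, N + 1 ≤ i → i ≤ M → Sak X a k i ω = b i}).toReal →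
        (P {ω | Sak X a k N ω = b N ∧ ∀ i, N + 1 ≤ i → i ≤ M → Sak X a k i ω = b i}).toReal /
            (P {ω | ∀ i, N + 1 ≤ i → i ≤ M → Sak X a k i ω = b i}).toReal
          = (P {ω | Sak X a k N ω = b N ∧ Sak X a k (N + 1) ω = b (N + 1)}).toReal /
            (P {ω | Sak X a k (N + 1) ω = b (N + 1)}).toReal) := by

  exact ⟨⟨Filter.Eventually.of_forall fun ω =>
      ⟨fun N => (stair_0 hX ω N).1, fun N => (stair_0 hX ω N).2⟩, s0_smc hX⟩,
    fun a k => ⟨Filter.Eventually.of_forall fun ω N haN => stair_ak hX a k ω haN,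
      fun N M haN hNM b hpos => ak_markov hX a k N M haN hNM b hpos⟩⟩

end VMCPaper
end

section
/- Let X be a virtual Markov chain. Then σ(X) = σ(S^0) ∨ σ(S^{a,k} : a,k ∈ ℕ): the σ-algebra generated by all random variables X_N(i) (N,i ∈ ℕ) is equal to the σ-algebra generated by all S^0_N (N ∈ ℕ) together with all S^{a,k}_N (a,k ∈ ℕ, N ≥ a). -/
open MeasureTheory Filter
open scoped ENNReal NNReal

namespace VMCPaper

lemma hitTime_eq_iff (x : Path) (A : Set ℕ) [DecidablePred fun j => x j ∈ A] (k i : ℕ) :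
    hitTime x A k = (i : ℕ∞) ↔ x i ∈ A ∧ Nat.count (fun j => x j ∈ A) i = k := by
  have key : ∀ (p : ℕ → Prop) (i : ℕ),
      (⨅ i ∈ {i : ℕ | p i}, (i : ℕ∞)) = (i : ℕ∞) ↔ p i ∧ ∀ j < i, ¬ p j := by
    intro p i
    constructor
    · intro h
      have hlow : ∀ j, p j → i ≤ j := by
        intro j hj
        have : (⨅ i ∈ {i : ℕ | p i}, (i : ℕ∞)) ≤ (j : ℕ∞) := iInf₂_le j hj
        rw [h] at this
        exact_mod_cast this
      refine ⟨?_, fun j hj hp => absurd (hlow j hp) (by omega)⟩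
      by_contra hpi
      have : ((i + 1 : ℕ) : ℕ∞) ≤ ⨅ i ∈ {i : ℕ | p i}, (i : ℕ∞) := by
        refine le_iInf₂ fun j hj => ?_
        have h1 := hlow j hj
        have h2 : j ≠ i := fun e => hpi (e ▸ hj)
        have : i + 1 ≤ j := by omega
        exact_mod_cast this
      rw [h] at this
      have : i + 1 ≤ i := by exact_mod_cast this
      omega
    · rintro ⟨h1, h2⟩
      apply le_antisymm
      · exact iInf₂_le i h1
      · refine le_iInf₂ fun j hj => ?_
        have : i ≤ j := by
          by_contra hlt
          exact h2 j (by omega) hj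
        exact_mod_cast this
  induction k generalizing i with
  | zero =>
    rw [hitTime, key]
    simp [Nat.count_iff_forall_not]
  | succ k ih =>
    rw [hitTime, key]
    constructor
    · rintro ⟨⟨h1, h2⟩, h3⟩
      refine ⟨h2, ?_⟩
      obtain ⟨m, hm⟩ := ENat.ne_top_iff_exists.mp h1.ne_top
      have hm' := (ih m).mp hm.symm
      rw [← hm] at h1
      have hmi : m < i := by exact_mod_cast h1
      have hcm : Nat.count (fun j => x j ∈ A) (m + 1) = k + 1 := by
        rw [Nat.count_succ, hm'.2]; simp [hm'.1]
      have : ∀ d, m + 1 + d ≤ i → Nat.count (fun j => x j ∈ A) (m + 1 + d) = k + 1 := by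
        intro d
        induction d with
        | zero => intro _; exact hcm
        | succ d ihd =>
          intro hd
          have hn : x (m + 1 + d) ∉ A := by
            intro hx
            refine h3 (m + 1 + d) (by omega) ⟨?_, hx⟩
            rw [← hm]
            have : m < m + 1 + d := by omega
            exact_mod_cast this
          rw [← add_assoc, Nat.count_succ, ihd (by omega)]
          simp [hn]
      have h := this (i - (m + 1)) (by omega)
      rwa [show m + 1 + (i - (m + 1)) = i by omega] at h
    · rintro ⟨h1, h2⟩
      have hex : ∀ i, Nat.count (fun j => x j ∈ A) i = k + 1 →
          ∃ m < i, x m ∈ A ∧ Nat.count (fun j => x j ∈ A) m = k := by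
        intro i
        induction i with
        | zero => intro h; simp at h
        | succ i ihi =>
          intro h
          rw [Nat.count_succ] at h
          by_cases hx : x i ∈ A
          · simp [hx] at h
            exact ⟨i, by omega, hx, h⟩
          · simp [hx] at h
            obtain ⟨m, hm, h⟩ := ihi h
            exact ⟨m, by omega, h⟩
      obtain ⟨m, hm, hmA, hmc⟩ := hex i h2
      have hh := (ih m).mpr ⟨hmA, hmc⟩
      rw [hh]
      refine ⟨⟨by exact_mod_cast hm, h1⟩, ?_⟩
      rintro j hj ⟨hmj, hjA⟩
      have hmj : m < j := by exact_mod_cast hmj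
      have e1 : Nat.count (fun j => x j ∈ A) (m + 1) = k + 1 := by
        rw [Nat.count_succ, hmc]; simp [hmA]
      have e2 := Nat.count_monotone (fun j => x j ∈ A) (show m + 1 ≤ j by omega)
      have e3 := Nat.count_monotone (fun j => x j ∈ A) (show j + 1 ≤ i by omega)
      rw [Nat.count_succ] at e3
      simp [hjA] at e3
      omega

lemma hitTime_ne_top_iff (x : Path) (A : Set ℕ) [DecidablePred fun j => x j ∈ A] (k : ℕ) :
    hitTime x A k ≠ ⊤ ↔ ∃ i, x i ∈ A ∧ Nat.count (fun j => x j ∈ A) i = k := by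
  rw [ENat.ne_top_iff_exists]
  refine exists_congr fun i => ?_
  rw [eq_comm, hitTime_eq_iff]

lemma hitTime_ne_top_anti (x : Path) (A : Set ℕ) (k : ℕ) (h : hitTime x A (k + 1) ≠ ⊤) :
    hitTime x A k ≠ ⊤ := by
  intro h2
  apply h
  simp [hitTime, h2]

lemma lt_Vis_iff {Ω : Type*} (X : Ω → ℕ → Path) (a k : ℕ) (ω : Ω) :
    (k : ℕ∞) < Vis X a ω ↔ hitTime (X ω a) {a} k ≠ ⊤ := by
  have anti : ∀ d m, hitTime (X ω a) {a} (m + d) ≠ ⊤ → hitTime (X ω a) {a} m ≠ ⊤ := by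
    intro d
    induction d with
    | zero => intro m h; exact h
    | succ d ih => intro m h; exact ih m (hitTime_ne_top_anti _ _ _ h)
  unfold Vis
  constructor
  · intro h hk
    refine absurd h (not_lt.mpr ?_)
    have hs : {k : ℕ | hitTime (X ω a) {a} k ≠ ⊤} ⊆ (Finset.range k : Set ℕ) := by
      intro m hm
      simp only [Finset.coe_range, Set.mem_Iio]
      by_contra hlt
      refine anti (m - k) k ?_ hk
      rw [show k + (m - k) = m by omega]
      exact hm
    refine (Set.encard_le_encard hs).trans ?_
    rw [Set.encard_coe_eq_coe_finsetCard]
    simp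
  · intro hk
    have hs : (Finset.range (k + 1) : Set ℕ) ⊆ {k : ℕ | hitTime (X ω a) {a} k ≠ ⊤} := by
      intro m hm
      simp only [Finset.coe_range, Set.mem_Iio] at hm
      refine anti (k - m) m ?_
      rw [show m + (k - m) = k by omega]
      exact hk
    refine lt_of_lt_of_le ?_ (Set.encard_le_encard hs)
    rw [Set.encard_coe_eq_coe_finsetCard, Finset.card_range]
    exact_mod_cast Nat.lt_succ_self k

open scoped Classical in
lemma proj_hit (N a : ℕ) (ha : a ≤ N) (x : Path) (k : ℕ) (h : hitTime x {a} k ≠ ⊤) :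
    hitTime (proj N x) {a} k ≠ ⊤ := by
  rw [hitTime_ne_top_iff] at h ⊢
  obtain ⟨i, hi, hc⟩ := h
  have hp : ∀ i, x i ≤ N → proj N x (Nat.count (fun j => x j ∈ {a | a ≤ N}) i) = x i := by
    intro i hi
    have := (hitTime_eq_iff x {a | a ≤ N} (Nat.count (fun j => x j ∈ {a | a ≤ N}) i) i).mpr
      ⟨hi, rfl⟩
    unfold proj
    rw [this]
    simp
  have hcount : ∀ i, Nat.count (fun j => proj N x j ∈ ({a} : Set ℕ))
      (Nat.count (fun j => x j ∈ {a | a ≤ N}) i) = Nat.count (fun j => x j ∈ ({a} : Set ℕ)) i := by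
    intro i
    induction i with
    | zero => simp
    | succ i ih =>
      by_cases hx : x i ≤ N
      · have h1 : Nat.count (fun j => x j ∈ {a | a ≤ N}) (i + 1)
            = Nat.count (fun j => x j ∈ {a | a ≤ N}) i + 1 := by
          rw [Nat.count_succ, if_pos (show x i ∈ {a | a ≤ N} from hx)]
        rw [h1, Nat.count_succ, ih, hp i hx, Nat.count_succ (fun j => x j ∈ ({a} : Set ℕ))]
      · have h1 : Nat.count (fun j => x j ∈ {a | a ≤ N}) (i + 1)
            = Nat.count (fun j => x j ∈ {a | a ≤ N}) i := by
          rw [Nat.count_succ, if_neg (show ¬ x i ∈ {a | a ≤ N} from hx), add_zero]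
        have h2 : ¬ x i ∈ ({a} : Set ℕ) := by
          intro e
          rw [Set.mem_singleton_iff] at e
          omega
        rw [h1, ih, Nat.count_succ, if_neg h2, add_zero]
  have hi' : x i = a := hi
  refine ⟨Nat.count (fun j => x j ∈ {a | a ≤ N}) i, ?_, ?_⟩
  · rw [hp i (by omega)]; exact hi
  · rw [hcount, hc]

open scoped Classical in
lemma Sak_eq_s14 {Ω : Type*} (X : Ω → ℕ → Path) (ω : Ω)
    (hp : ∀ N, proj N (X ω (N + 1)) = X ω N) (N i a : ℕ) (ha : a ≤ N) (hi : X ω N i = a) :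
    Sak X a (Nat.count (fun j => X ω N j ∈ ({a} : Set ℕ)) i) N ω = X ω N (i + 1) := by
  set k := Nat.count (fun j => X ω N j ∈ ({a} : Set ℕ)) i with hk
  have h1 : hitTime (X ω N) {a} k = (i : ℕ∞) := (hitTime_eq_iff _ _ _ _).mpr ⟨hi, hk.symm⟩
  have h2 : ∀ d, hitTime (X ω (a + d)) {a} k ≠ ⊤ → hitTime (X ω a) {a} k ≠ ⊤ := by
    intro d
    induction d with
    | zero => exact id
    | succ d ih =>
      intro h
      apply ih
      rw [← hp]
      exact proj_hit _ _ (by omega) _ _ h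
  have h3 : hitTime (X ω N) {a} k ≠ ⊤ := by rw [h1]; simp
  have h4 : (k : ℕ∞) < Vis X a ω := by
    rw [lt_Vis_iff]
    apply h2 (N - a)
    rwa [show a + (N - a) = N by omega]
  unfold Sak
  rw [if_pos ⟨h4, h3⟩, h1]
  simp

open scoped Classical in
lemma measurable_count {Ω : Type*} {m : MeasurableSpace Ω} (Y : Ω → ℕ → ℕ) (a n : ℕ)
    (h : ∀ i < n, Measurable fun ω => Y ω i) :
    Measurable fun ω => Nat.count (fun j => Y ω j ∈ ({a} : Set ℕ)) n := by
  induction n with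
  | zero => simp
  | succ n ih =>
    simp only [Nat.count_succ]
    refine (ih fun i hi => h i (by omega)).add ?_
    exact Measurable.ite ((h n (by omega)) (MeasurableSet.singleton a)) measurable_const
      measurable_const

open scoped Classical in
lemma measurable_Sak {Ω : Type*} {m : MeasurableSpace Ω} (X : Ω → ℕ → Path) (hX : Measurable X)
    (a k N : ℕ) : Measurable (Sak X a k N) := by
  have hXi : ∀ N i, Measurable fun ω => X ω N i := fun N i =>
    (measurable_pi_apply i).comp ((measurable_pi_apply N).comp hX)
  have hset : ∀ N i : ℕ, MeasurableSet {ω | hitTime (X ω N) {a} k = (i : ℕ∞)} := by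
    intro N i
    have e : {ω | hitTime (X ω N) {a} k = (i : ℕ∞)} = {ω | X ω N i ∈ ({a} : Set ℕ)} ∩
        {ω | Nat.count (fun j => X ω N j ∈ ({a} : Set ℕ)) i ∈ ({k} : Set ℕ)} := by
      ext ω
      exact hitTime_eq_iff (X ω N) {a} k i
    rw [e]
    exact ((hXi N i) (MeasurableSet.singleton a)).inter
      ((measurable_count (fun ω => X ω N) a i fun i _ => hXi N i) (MeasurableSet.singleton k))
  have htop : ∀ N, MeasurableSet {ω | hitTime (X ω N) {a} k ≠ ⊤} := by
    intro N
    have : {ω | hitTime (X ω N) {a} k ≠ ⊤} = ⋃ i : ℕ, {ω | hitTime (X ω N) {a} k = (i : ℕ∞)} := by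
      ext ω
      simp only [Set.mem_ofPred_eq, Set.mem_iUnion, ENat.ne_top_iff_exists, eq_comm]
    rw [this]
    exact MeasurableSet.iUnion fun i => hset N i
  have hT : Measurable fun ω => (hitTime (X ω N) {a} k).toNat := by
    refine measurable_to_countable' fun i => ?_
    have : (fun ω => (hitTime (X ω N) {a} k).toNat) ⁻¹' {i}
        = {ω | hitTime (X ω N) {a} k = (i : ℕ∞)} ∪
          (if i = 0 then {ω | hitTime (X ω N) {a} k ≠ ⊤}ᶜ else ∅) := by
      ext ω
      by_cases hi : i = 0
      · subst hi
        simp [ENat.toNat_eq_zero]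
      · simp [hi, ENat.toNat_eq_iff hi]
    rw [this]
    refine (hset N i).union ?_
    split_ifs
    · exact (htop N).compl
    · exact MeasurableSet.empty
  unfold Sak
  simp only [lt_Vis_iff]
  refine Measurable.ite ((htop a).inter (htop N)) ?_ measurable_const
  have hj : Measurable fun p : Ω × ℕ => X p.1 N (p.2 + 1) :=
    measurable_from_prod_countable_left fun n => hXi N (n + 1)
  exact hj.comp (measurable_id.prodMk hT)

/-- the σ-algebra generated by a VMC equals the σ-algebra generated by its
staircase decomposition. -/
theorem statement14 {Ω : Type*} [MeasurableSpace Ω] (P : Measure Ω) (X : Ω → ℕ → Path)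
    (hX : IsVMC P X) :
    MeasurableSpace.comap X inferInstance
      = MeasurableSpace.comap (fun ω (N : ℕ) => S0 X N ω) inferInstance
        ⊔ ⨆ (a : ℕ) (k : ℕ),
            MeasurableSpace.comap (fun ω (N : ℕ) => Sak X a k (a + N) ω) inferInstance := by
  classical
  obtain ⟨-, -, hps, hp, -⟩ := hX
  apply le_antisymm
  · set m : MeasurableSpace Ω := MeasurableSpace.comap (fun ω (N : ℕ) => S0 X N ω) inferInstance
        ⊔ ⨆ (a : ℕ) (k : ℕ),
            MeasurableSpace.comap (fun ω (N : ℕ) => Sak X a k (a + N) ω) inferInstance with hm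
    have h0 : ∀ N, Measurable[m] fun ω => X ω N 0 := by
      intro N
      have h : Measurable[m] fun ω (N : ℕ) => S0 X N ω :=
        (comap_measurable _).mono le_sup_left le_rfl
      exact (measurable_pi_apply N).comp h
    have hS : ∀ a k N, a ≤ N → Measurable[m] (Sak X a k N) := by
      intro a k N ha
      have h : Measurable[m] fun ω (N : ℕ) => Sak X a k (a + N) ω :=
        (comap_measurable _).mono (le_sup_of_le_right (le_iSup₂_of_le a k le_rfl)) le_rfl
      have h' := (measurable_pi_apply (N - a)).comp h
      have e : a + (N - a) = N := by omega
      simpa [Function.comp_def, e] using h'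
    have hXi : ∀ N i, Measurable[m] fun ω => X ω N i := by
      intro N i
      induction i using Nat.strong_induction_on with
      | _ i ih =>
        cases i with
        | zero => exact h0 N
        | succ i =>
          refine @measurable_to_countable' _ _ _ _ m _ fun b => ?_
          have : (fun ω => X ω N (i + 1)) ⁻¹' {b} = ⋃ (a : ℕ) (k : ℕ) (_ : a ≤ N),
              ({ω | X ω N i ∈ ({a} : Set ℕ)} ∩
                {ω | Nat.count (fun j => X ω N j ∈ ({a} : Set ℕ)) i ∈ ({k} : Set ℕ)}) ∩
                {ω | Sak X a k N ω ∈ ({b} : Set ℕ)} := by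
            ext ω
            simp only [Set.mem_iUnion]
            constructor
            · intro h
              refine ⟨X ω N i, _, (hps ω N).1 i, ⟨rfl, rfl⟩, ?_⟩
              have h' := Sak_eq_s14 X ω (hp ω) N i (X ω N i) ((hps ω N).1 i) rfl
              exact h'.trans h
            · rintro ⟨a, k, ha, ⟨h1, h2⟩, h3⟩
              have h' := Sak_eq_s14 X ω (hp ω) N i a ha h1
              have h2' : Nat.count (fun j => X ω N j ∈ ({a} : Set ℕ)) i = k := h2
              rw [h2'] at h'
              exact h'.symm.trans h3
          rw [this]
          refine MeasurableSet.iUnion fun a => MeasurableSet.iUnion fun k =>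
            MeasurableSet.iUnion fun ha => ?_
          refine MeasurableSet.inter (MeasurableSet.inter ?_ ?_) ?_
          · exact (ih i (by omega)) (MeasurableSet.singleton a)
          · exact (measurable_count (m := m) (fun ω => X ω N) a i fun j hj => ih j (by omega))
              (MeasurableSet.singleton k)
          · exact (hS a k N ha) (MeasurableSet.singleton b)
    have hXm : Measurable[m] X :=
      measurable_pi_lambda _ fun N => measurable_pi_lambda _ fun i => hXi N i
    exact hXm.comap_le
  · have hXm : Measurable[MeasurableSpace.comap X inferInstance] X := comap_measurable X
    refine sup_le ?_ (iSup₂_le fun a k => ?_)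
    · refine @Measurable.comap_le _ _ (MeasurableSpace.comap X inferInstance) _ _
        (@measurable_pi_lambda _ _ _ (MeasurableSpace.comap X inferInstance) _ _ fun N => ?_)
      exact (measurable_pi_apply 0).comp ((measurable_pi_apply N).comp hXm)
    · refine @Measurable.comap_le _ _ (MeasurableSpace.comap X inferInstance) _ _
        (@measurable_pi_lambda _ _ _ (MeasurableSpace.comap X inferInstance) _ _ fun N => ?_)
      exact measurable_Sak X hXm a k (a + N)

end VMCPaper
end

section
/- If a virtual Markov chain X is classical, then 𝒯(X) = σ(X) almost surely: 𝒯(X) ⊆ σ(X), and for every A ∈ σ(X) there exists B ∈ 𝒯(X) with P(A △ B) = 0. In particular, for a classical VMC, 𝒯(X) is trivial if and only if every event in σ(X) has probability 0 or 1. -/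
open MeasureTheory Filter
open scoped ENNReal NNReal

namespace VMCPaper

theorem measurable_hitTime (A : Set ℕ) (k : ℕ) : Measurable (fun x : Path => hitTime x A k) := by
  classical
  have : BorelSpace ℕ∞ := ⟨borel_eq_top_of_countable.symm⟩
  have hA : ∀ i : ℕ, MeasurableSet {x : Path | x i ∈ A} := fun i =>
    (measurable_pi_apply i) (MeasurableSet.of_discrete (s := A))
  induction k with
  | zero =>
    simp only [hitTime]
    refine Measurable.iInf fun i => ?_
    have : (fun x : Path => ⨅ (_ : i ∈ {i : ℕ | x i ∈ A}), (i : ℕ∞))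
        = {x : Path | x i ∈ A}.piecewise (fun _ => (i : ℕ∞)) (fun _ => ⊤) := by
      funext x
      by_cases h : x i ∈ A <;> simp [Set.piecewise, h]
    rw [this]
    exact Measurable.piecewise (hA i) measurable_const measurable_const
  | succ k ih =>
    simp only [hitTime]
    refine Measurable.iInf fun i => ?_
    have : (fun x : Path => ⨅ (_ : i ∈ {i : ℕ | hitTime x A k < (i : ℕ∞) ∧ x i ∈ A}), (i : ℕ∞))
        = ({x : Path | hitTime x A k < (i : ℕ∞)} ∩ {x : Path | x i ∈ A}).piecewise
            (fun _ => (i : ℕ∞)) (fun _ => ⊤) := by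
      funext x
      by_cases h : hitTime x A k < (i : ℕ∞) <;> by_cases h' : x i ∈ A <;>
        simp [Set.piecewise, h, h']
    rw [this]
    exact Measurable.piecewise ((ih measurableSet_Iio).inter (hA i))
      measurable_const measurable_const

theorem measurable_proj (N : ℕ) : Measurable (proj N) := by
  refine measurable_pi_iff.2 fun i => ?_
  unfold proj
  refine Measurable.ite
    ((measurable_hitTime {a | a ≤ N} i) (measurableSet_singleton (⊤ : ℕ∞))) measurable_const ?_
  have h : Measurable (fun p : ℕ × Path => p.2 p.1) :=
    measurable_from_prod_countable_right fun n => measurable_pi_apply n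
  have hn : Measurable (fun x : Path => (hitTime x {a | a ≤ N} i).toNat) :=
    (Measurable.of_discrete (f := ENat.toNat)).comp (measurable_hitTime _ i)
  exact h.comp (hn.prodMk measurable_id)

theorem tail_eq {Ω : Type*} (X : Ω → ℕ → Path)
    (hp : ∀ ω N, proj N (X ω (N + 1)) = X ω N) : tailVMC X = sigmaX X := by
  apply le_antisymm
  · refine (iInf_le _ 0).trans ?_
    simp [sigmaX]
  · refine le_iInf fun N => ?_
    rw [sigmaX, ← measurable_iff_comap_le]
    let m : MeasurableSpace Ω :=
      MeasurableSpace.comap (fun ω (M : ℕ) => X ω (N + M)) inferInstance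
    have h0 : Measurable[m] (fun ω (M : ℕ) => X ω (N + M)) := comap_measurable _
    have h1 : ∀ M, Measurable[m] (fun ω => X ω (N + M)) := fun M =>
      (measurable_pi_apply M).comp h0
    have h2 : ∀ d M, M + d = N → Measurable[m] (fun ω => X ω M) := by
      intro d
      induction d with
      | zero => intro M hM; have := h1 0; rw [← hM] at this; simpa using this
      | succ d ih =>
        intro M hM
        have := (measurable_proj M).comp (ih (M + 1) (by omega))
        simpa [Function.comp_def, hp] using this
    refine @measurable_pi_iff _ _ _ m _ _ |>.2 fun M => ?_
    rcases le_total M N with h | h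
    · exact h2 (N - M) M (by omega)
    · have := h1 (M - N); rwa [Nat.add_sub_cancel' h] at this

/-- for a classical VMC, the tail σ-algebra equals the generated σ-algebra up
to null sets; in particular the tail is trivial iff every event generated by the chain has
probability `0` or `1`. -/
theorem statement16 {Ω : Type*} [MeasurableSpace Ω] (P : Measure Ω) (X : Ω → ℕ → Path)
    (hX : IsVMC P X) (hcl : IsClassical P X) :
    tailVMC X ≤ sigmaX X ∧
    (∀ A : Set Ω, MeasurableSet[sigmaX X] A →
      ∃ B : Set Ω, MeasurableSet[tailVMC X] B ∧ P ((A \ B) ∪ (B \ A)) = 0) ∧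
    (TailTrivial P X ↔
      ∀ A : Set Ω, MeasurableSet[sigmaX X] A → P A = 0 ∨ P A = 1) := by
  have h := tail_eq X hX.2.2.2.1
  refine ⟨h.le, fun A hA => ⟨A, h ▸ hA, by simp⟩, ?_⟩
  unfold TailTrivial
  rw [h]

end VMCPaper
end
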